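/- arXiv:math/0403176 — 5 statements merged into one kernel-verified Lean document; each statement's English description precedes it below -/
import Mathlib

section
/- Let p be a prime, x ∈ ℚ_p, and e ∈ ℤ with e ≥ 0 and e ≤ v_p(x) (the latter automatically holds when x = 0). Then the p-adic ball B(x, p^{-e}) is μ-measurable with height measure μ(B(x, p^{-e})) = p^{1-e}/(p+1); that is, the ratio #{r ∈ ℚ : H(r) ≤ T and |r − x|_p ≤ p^{-e}} / #{r ∈ ℚ : H(r) ≤ T} tends to p^{1-e}/(p+1) as T → ∞. -/
/-- The height of a rational number: for `r = m/n` in lowest terms,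
`H(r) = max (|m|, n)`; in particular `H(0) = 1`. -/
def ratHeight (r : ℚ) : ℕ := max r.num.natAbs r.den

open Finset Filter Topology ArithmeticFunction in
/-- Summing the Möbius function over the divisors of `n` detects `n = 1`. -/
lemma sum_divisors_moebius_eq_ite (n : ℕ) :
    ∑ d ∈ n.divisors, moebius d = if n = 1 then 1 else 0 := by
  have h := congrArg (fun f : ArithmeticFunction ℤ => f n) coe_zeta_mul_moebius
  simpa only [coe_zeta_mul_apply, ArithmeticFunction.one_apply] using h

open Finset in
/-- Möbius inversion for counting coprime pairs in a box. -/
lemma card_coprime_pairs_eq_sum_moebius (X Y : ℕ) (S : ℕ → Prop) [DecidablePred S] :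
    (#{z ∈ Ioc 0 X ×ˢ Ioc 0 Y | z.1.Coprime z.2 ∧ S z.2} : ℤ) =
      ∑ d ∈ Ioc 0 X, ArithmeticFunction.moebius d *
        (((X / d : ℕ) : ℤ) * (#{n ∈ Ioc 0 Y | d ∣ n ∧ S n} : ℤ)) := by
  have key : ∀ z ∈ Ioc 0 X ×ˢ Ioc 0 Y,
      (if z.1.Coprime z.2 ∧ S z.2 then (1 : ℤ) else 0) =
        ∑ d ∈ Ioc 0 X, ArithmeticFunction.moebius d *
          ((if d ∣ z.1 then 1 else 0) * (if d ∣ z.2 ∧ S z.2 then 1 else 0)) := by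
    rintro ⟨m, n⟩ hz
    simp only [mem_product, mem_Ioc] at hz
    obtain ⟨⟨hm, hmX⟩, hn, -⟩ := hz
    by_cases hS : S n
    · have hsub : {d ∈ Ioc 0 X | d ∣ m ∧ d ∣ n} = (m.gcd n).divisors := by
        ext d
        simp only [mem_filter, mem_Ioc, Nat.mem_divisors, Nat.dvd_gcd_iff]
        constructor
        · rintro ⟨-, h⟩
          exact ⟨h, (Nat.gcd_pos_of_pos_left n hm).ne'⟩
        · rintro ⟨h, -⟩
          exact ⟨⟨Nat.pos_of_dvd_of_pos h.1 hm, (Nat.le_of_dvd hm h.1).trans hmX⟩, h⟩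
      have h := sum_divisors_moebius_eq_ite (m.gcd n)
      rw [← hsub, sum_filter] at h
      simp only [hS, and_true, Nat.Coprime, ← h]
      refine sum_congr rfl fun d _ => ?_
      by_cases h1 : d ∣ m <;> by_cases h2 : d ∣ n <;> simp [h1, h2]
    · simp [hS]
  rw [card_filter]
  simp only [Nat.cast_sum, Nat.cast_ite, Nat.cast_one, Nat.cast_zero]
  rw [sum_congr rfl key, sum_comm]
  refine sum_congr rfl fun d _ => ?_
  rw [← mul_sum, ← Nat.Ioc_filter_dvd_card_eq_div, card_filter, card_filter]
  simp only [Nat.cast_sum, Nat.cast_ite, Nat.cast_one, Nat.cast_zero]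
  rw [sum_mul_sum, sum_product]

open Filter Topology in
lemma tendsto_natCast_div_div (k : ℕ) :
    Tendsto (fun T : ℕ => ((T / k : ℕ) : ℝ) / T) atTop (𝓝 (1 / k)) := by
  have h := (tendsto_nat_floor_mul_div_atTop (R := ℝ) (a := 1 / k) (by positivity)).comp
    tendsto_natCast_atTop_atTop
  refine h.congr fun T => ?_
  have : (1 / (k : ℝ)) * T = (T : ℝ) / k := by ring
  simp only [Function.comp_apply, this, Nat.floor_div_eq_div]

open Filter Topology Finset in
/-- Asymptotic number of coprime pairs `(m, n)` with `m ≤ T / q`, `n ≤ T` and `n` in a set all of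
whose intersections with the progressions `d ℕ` have a density `ν d`. -/
lemma tendsto_card_coprime_pairs (q : ℕ) (S : ℕ → Prop) [DecidablePred S] (ν : ℕ → ℝ)
    (hν : ∀ d : ℕ, 0 < d →
      Tendsto (fun T : ℕ => (#{n ∈ Ioc 0 T | d ∣ n ∧ S n} : ℝ) / T) atTop (𝓝 (ν d))) :
    Tendsto (fun T : ℕ =>
        (#{z ∈ Ioc 0 (T / q) ×ˢ Ioc 0 T | z.1.Coprime z.2 ∧ S z.2} : ℝ) / (T : ℝ) ^ 2) atTop
      (𝓝 (∑' d : ℕ, (ArithmeticFunction.moebius d : ℝ) * ((1 / ((q * d : ℕ) : ℝ)) * ν d))) := by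
  have hsum : ∀ T : ℕ,
      (#{z ∈ Ioc 0 (T / q) ×ˢ Ioc 0 T | z.1.Coprime z.2 ∧ S z.2} : ℝ) / (T : ℝ) ^ 2 =
      ∑' d : ℕ, (ArithmeticFunction.moebius d : ℝ) *
        ((((T / (q * d) : ℕ) : ℝ) / T) * ((#{n ∈ Ioc 0 T | d ∣ n ∧ S n} : ℝ) / T)) := by
    intro T
    have h := congrArg (fun a : ℤ => (a : ℝ)) (card_coprime_pairs_eq_sum_moebius (T / q) T S)
    simp only [Int.cast_natCast, Int.cast_sum, Int.cast_mul] at h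
    rw [h, sum_div, tsum_eq_sum (s := Ioc 0 (T / q))]
    · refine sum_congr rfl fun d _ => ?_
      rw [Nat.div_div_eq_div_mul]
      ring
    · intro d hd
      rcases Nat.eq_zero_or_pos d with rfl | hd0
      · simp
      · have hlt : T / q < d := by
          by_contra hcon
          exact hd (mem_Ioc.2 ⟨hd0, not_lt.1 hcon⟩)
        rw [← Nat.div_div_eq_div_mul, Nat.div_eq_of_lt hlt]
        simp
  simp_rw [hsum]
  refine tendsto_tsum_of_dominated_convergence (bound := fun d : ℕ => 1 / (d : ℝ) ^ 2)
    (Real.summable_one_div_nat_pow.2 one_lt_two) (fun d => ?_) (Eventually.of_forall fun T d => ?_)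
  · rcases Nat.eq_zero_or_pos d with rfl | hd0
    · simp
    · exact ((tendsto_natCast_div_div (q * d)).mul (hν d hd0)).const_mul _
  · have hmu : |(ArithmeticFunction.moebius d : ℝ)| ≤ 1 := by
      exact_mod_cast ArithmeticFunction.abs_moebius_le_one (n := d)
    have hle : ∀ a : ℕ, a ≤ T / d → (a : ℝ) / T ≤ 1 / d := by
      intro a ha
      rcases Nat.eq_zero_or_pos T with rfl | hT
      · simp
      · have hT' : (0 : ℝ) < T := by exact_mod_cast hT
        rw [div_le_iff₀ hT']
        calc (a : ℝ) ≤ ((T / d : ℕ) : ℝ) := by exact_mod_cast ha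
          _ ≤ (T : ℝ) / d := Nat.cast_div_le
          _ = 1 / d * T := by ring
    have h1 : ((T / (q * d) : ℕ) : ℝ) / T ≤ 1 / d := by
      refine hle _ ?_
      rw [← Nat.div_div_eq_div_mul]
      exact Nat.div_le_div_right (Nat.div_le_self T q)
    have h2 : (#{n ∈ Ioc 0 T | d ∣ n ∧ S n} : ℝ) / T ≤ 1 / d := by
      refine hle _ ?_
      rw [← Nat.Ioc_filter_dvd_card_eq_div]
      exact card_le_card (monotone_filter_right _ fun n _ h => h.1)
    have h12 := mul_le_mul h1 h2 (by positivity) (by positivity)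
    rw [norm_mul, Real.norm_eq_abs, Real.norm_of_nonneg (by positivity)]
    calc _ ≤ 1 * (1 / (d : ℝ) * (1 / d)) := mul_le_mul hmu h12 (by positivity) zero_le_one
      _ = 1 / (d : ℝ) ^ 2 := by ring

lemma summable_moebius_div_sq :
    Summable fun d : ℕ => (ArithmeticFunction.moebius d : ℝ) / (d : ℝ) ^ 2 := by
  refine (Real.summable_one_div_nat_pow.2 one_lt_two).of_norm_bounded fun d => ?_
  have hmu : |(ArithmeticFunction.moebius d : ℝ)| ≤ 1 := by
    exact_mod_cast ArithmeticFunction.abs_moebius_le_one (n := d)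
  rw [norm_div, Real.norm_eq_abs, Real.norm_of_nonneg (by positivity)]
  gcongr

lemma tsum_moebius_div_sq_ne_zero :
    ∑' d : ℕ, (ArithmeticFunction.moebius d : ℝ) / (d : ℝ) ^ 2 ≠ 0 := by
  intro h
  have h1 := ArithmeticFunction.LSeries_zeta_mul_Lseries_moebius (s := 2) (by norm_num)
  have h2 : LSeries (fun n : ℕ => ((ArithmeticFunction.moebius n : ℤ) : ℂ)) 2 = 0 := by
    have h3 := congrArg (fun a : ℝ => (a : ℂ)) h
    simp only [Complex.ofReal_tsum, Complex.ofReal_zero] at h3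
    rw [LSeries, ← h3]
    refine tsum_congr fun d => ?_
    rcases Nat.eq_zero_or_pos d with rfl | hd
    · simp
    · rw [LSeries.term_of_ne_zero hd.ne']
      norm_cast
  rw [h2, mul_zero] at h1
  exact zero_ne_one h1

/-- Removing the Euler factor at `p` from `∑ μ(d) / d²`. -/
lemma tsum_moebius_div_sq_eq_mul {p : ℕ} (hp : p.Prime) :
    ∑' d : ℕ, (ArithmeticFunction.moebius d : ℝ) / (d : ℝ) ^ 2 =
      (1 - 1 / (p : ℝ) ^ 2) *
        ∑' d : ℕ, if p ∣ d then 0 else (ArithmeticFunction.moebius d : ℝ) / (d : ℝ) ^ 2 := by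
  set u : ℕ → ℝ := fun d => (ArithmeticFunction.moebius d : ℝ) / (d : ℝ) ^ 2 with hu
  have hs : Summable u := summable_moebius_div_sq
  have hv : Summable fun d : ℕ => if p ∣ d then 0 else u d := by
    refine hs.norm.of_norm_bounded fun d => ?_
    split_ifs <;> simp
  have hw : Summable fun d : ℕ => if p ∣ d then u d else 0 := by
    refine hs.norm.of_norm_bounded fun d => ?_
    split_ifs <;> simp
  have hsplit : ∑' d, u d = (∑' d, if p ∣ d then 0 else u d) + ∑' d, if p ∣ d then u d else 0 := by
    rw [← hv.tsum_add hw]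
    refine tsum_congr fun d => ?_
    split_ifs <;> simp
  have hinj : Function.Injective (fun k : ℕ => p * k) :=
    fun a b h => Nat.eq_of_mul_eq_mul_left hp.pos h
  have hmul : (∑' d, if p ∣ d then u d else 0) =
      -(1 / (p : ℝ) ^ 2) * ∑' d, if p ∣ d then 0 else u d := by
    rw [← hinj.tsum_eq, ← tsum_mul_left]
    · refine tsum_congr fun k => ?_
      by_cases hk : p ∣ k
      · have : ArithmeticFunction.moebius (p * k) = 0 := by
          apply ArithmeticFunction.moebius_eq_zero_of_not_squarefree
          intro hsq
          exact hp.one_lt.ne' (Nat.isUnit_iff.1 (hsq p (mul_dvd_mul_left p hk)))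
        simp [hu, hk, this]
      · have : ArithmeticFunction.moebius (p * k) = -ArithmeticFunction.moebius k := by
          rw [ArithmeticFunction.isMultiplicative_moebius.map_mul_of_coprime
            ((Nat.Prime.coprime_iff_not_dvd hp).2 hk), ArithmeticFunction.moebius_apply_prime hp]
          ring
        simp only [hu, hk, this, dvd_mul_right, if_true, if_false]
        push_cast
        rw [mul_pow, neg_mul, div_mul_div_comm, one_mul, neg_div]
    · intro d hd
      simp only [Function.mem_support, ne_eq, ite_eq_right_iff, not_forall] at hd
      obtain ⟨⟨k, rfl⟩, -⟩ := hd
      exact ⟨k, rfl⟩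
  rw [hsplit, hmul]
  ring

open Filter Topology Finset in
lemma tendsto_card_dvd_and_not_dvd {p : ℕ} (hp : p.Prime) (d : ℕ) :
    Tendsto (fun T : ℕ => (#{n ∈ Ioc 0 T | d ∣ n ∧ ¬ p ∣ n} : ℝ) / T) atTop
      (𝓝 (if p ∣ d then 0 else (1 / (d : ℝ)) * (1 - 1 / p))) := by
  by_cases hpd : p ∣ d
  · have : ∀ T : ℕ, #{n ∈ Ioc 0 T | d ∣ n ∧ ¬ p ∣ n} = 0 := by
      intro T
      rw [card_eq_zero, filter_eq_empty_iff]
      exact fun n _ h => h.2 (hpd.trans h.1)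
    simp [this, hpd]
  · have hcop : d.Coprime p := ((Nat.Prime.coprime_iff_not_dvd hp).2 hpd).symm
    have hcard : ∀ T : ℕ,
        (#{n ∈ Ioc 0 T | d ∣ n ∧ ¬ p ∣ n} : ℝ) = ((T / d : ℕ) : ℝ) - ((T / (d * p) : ℕ) : ℝ) := by
      intro T
      have h := card_filter_add_card_filter_not (s := {n ∈ Ioc 0 T | d ∣ n}) (fun n => p ∣ n)
      rw [filter_filter, filter_filter, Nat.Ioc_filter_dvd_card_eq_div] at h
      have h2 : {n ∈ Ioc 0 T | d ∣ n ∧ p ∣ n} = {n ∈ Ioc 0 T | d * p ∣ n} := by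
        refine filter_congr fun n _ => ?_
        exact ⟨fun h => hcop.mul_dvd_of_dvd_of_dvd h.1 h.2,
          fun h => ⟨(dvd_mul_right d p).trans h, (dvd_mul_left p d).trans h⟩⟩
      rw [h2, Nat.Ioc_filter_dvd_card_eq_div] at h
      rw [← h]
      push_cast
      ring
    simp only [hcard, hpd, if_false, sub_div]
    have h := (tendsto_natCast_div_div d).sub (tendsto_natCast_div_div (d * p))
    have heq : (1 / (d : ℝ)) * (1 - 1 / p) = 1 / (d : ℝ) - 1 / ((d * p : ℕ) : ℝ) := by
      push_cast
      rw [one_div_mul_eq_div, sub_div, div_div, mul_comm (p : ℝ)]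
    rwa [heq]

open Finset in
/-- Rationals of height at most `T` satisfying a sign-independent condition on numerator and
denominator, counted through coprime pairs of positive integers. -/
lemma card_ratHeight_le_and (Q : ℕ → ℕ → Prop) [DecidableRel Q] {T : ℕ} (hT : 0 < T) :
    Nat.card {r : ℚ // ratHeight r ≤ T ∧ Q r.num.natAbs r.den} =
      (if Q 0 1 then 1 else 0) +
        2 * #{z ∈ Ioc 0 T ×ˢ Ioc 0 T | z.1.Coprime z.2 ∧ Q z.1 z.2} := by
  set P := {z ∈ Ioc 0 T ×ˢ Ioc 0 T | z.1.Coprime z.2 ∧ Q z.1 z.2} with hP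
  have hmem : ∀ z, z ∈ P ↔
      ((0 < z.1 ∧ z.1 ≤ T) ∧ 0 < z.2 ∧ z.2 ≤ T) ∧ z.1.Coprime z.2 ∧ Q z.1 z.2 := by
    intro z
    simp [hP]
  let f : ℕ × ℕ → ℚ := fun z => (z.1 : ℚ) / z.2
  have hnum : ∀ z ∈ P, (f z).num = z.1 := by
    intro z hz
    have h := (hmem z).1 hz
    have := Rat.num_div_eq_of_coprime (a := (z.1 : ℤ)) (b := (z.2 : ℤ))
      (by exact_mod_cast h.1.2.1) (by simpa using h.2.1)
    simpa [f] using this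
  have hden : ∀ z ∈ P, (f z).den = z.2 := by
    intro z hz
    have h := (hmem z).1 hz
    have := Rat.den_div_eq_of_coprime (a := (z.1 : ℤ)) (b := (z.2 : ℤ))
      (by exact_mod_cast h.1.2.1) (by simpa using h.2.1)
    have h2 : (((f z).den : ℕ) : ℤ) = z.2 := by simpa [f] using this
    exact_mod_cast h2
  have hinj : Set.InjOn f P := by
    intro a ha b hb hab
    have h1 : (a.1 : ℤ) = b.1 := by rw [← hnum a ha, ← hnum b hb, hab]
    have h2 : a.2 = b.2 := by rw [← hden a ha, ← hden b hb, hab]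
    exact Prod.ext (by exact_mod_cast h1) h2
  have hpos : ∀ z ∈ P, 0 < f z := by
    intro z hz
    have h := (hmem z).1 hz
    exact div_pos (by exact_mod_cast h.1.1.1) (by exact_mod_cast h.1.2.1)
  let Z : Finset ℚ := if Q 0 1 then {0} else ∅
  have hZ : ∀ r ∈ Z, r = 0 := by
    intro r hr
    by_cases h : Q 0 1 <;> simp [Z, h] at hr; exact hr
  have hset : {r : ℚ | ratHeight r ≤ T ∧ Q r.num.natAbs r.den} =
      ((Z ∪ (P.image f ∪ P.image fun z => -f z) : Finset ℚ) : Set ℚ) := by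
    ext r
    simp only [Set.mem_ofPred_eq, mem_coe, mem_union, mem_image]
    constructor
    · rintro ⟨hr, hQ⟩
      have hr' : r.num.natAbs ≤ T ∧ r.den ≤ T := max_le_iff.1 hr
      rcases eq_or_ne r 0 with rfl | hr0
      · left
        have : Q 0 1 := by simpa using hQ
        simp [Z, this]
      · right
        have hz : (r.num.natAbs, r.den) ∈ P :=
          (hmem _).2 ⟨⟨⟨Int.natAbs_pos.2 (Rat.num_ne_zero.2 hr0), hr'.1⟩, r.pos, hr'.2⟩,
            r.reduced, hQ⟩
        rcases lt_or_gt_of_ne hr0 with h | h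
        · right
          refine ⟨_, hz, ?_⟩
          have h1 : ((r.num.natAbs : ℤ) : ℚ) = -r.num := by
            rw [Int.ofNat_natAbs_of_nonpos (Rat.num_neg.2 h).le]
            push_cast
            rfl
          simp only [f]
          rw [← Int.cast_natCast (R := ℚ), h1, neg_div, neg_neg, Rat.num_div_den]
        · left
          refine ⟨_, hz, ?_⟩
          have h1 : ((r.num.natAbs : ℤ) : ℚ) = r.num := by
            rw [Int.natAbs_of_nonneg (Rat.num_pos.2 h).le]
          simp only [f]
          rw [← Int.cast_natCast (R := ℚ), h1, Rat.num_div_den]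
    · rintro (hr | ⟨z, hz, rfl⟩ | ⟨z, hz, rfl⟩)
      · obtain rfl := hZ r hr
        have : Q 0 1 := by
          by_contra h
          simp [Z, h] at hr
        exact ⟨max_le (by simp) (by simpa using Nat.succ_le_of_lt hT), by simpa using this⟩
      · have h := (hmem z).1 hz
        simpa [ratHeight, hnum z hz, hden z hz] using ⟨⟨h.1.1.2, h.1.2.2⟩, h.2.2⟩
      · have h := (hmem z).1 hz
        simpa [ratHeight, hnum z hz, hden z hz] using ⟨⟨h.1.1.2, h.1.2.2⟩, h.2.2⟩
  have hcard : Nat.card {r : ℚ // ratHeight r ≤ T ∧ Q r.num.natAbs r.den} =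
      #(Z ∪ (P.image f ∪ P.image fun z => -f z)) := by
    rw [← Set.ncard_coe_finset, ← hset]
    rfl
  rw [hcard, card_union_of_disjoint, card_union_of_disjoint, card_image_of_injOn hinj,
    card_image_of_injOn (fun a ha b hb hab => hinj ha hb (neg_injective hab)), two_mul]
  · congr 1
    by_cases h : Q 0 1 <;> simp [Z, h]
  · rw [disjoint_left]
    intro r h1 h2
    obtain ⟨a, ha, rfl⟩ := mem_image.1 h1
    obtain ⟨b, hb, hab⟩ := mem_image.1 h2
    have := hpos a ha
    have := hpos b hb
    linarith
  · rw [disjoint_left]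
    intro r h1 h2
    obtain rfl := hZ r h1
    rcases mem_union.1 h2 with h2 | h2 <;> obtain ⟨a, ha, hab⟩ := mem_image.1 h2 <;>
      have := hpos a ha <;> linarith

/-- The norm of a rational in `ℚ_[p]` is at most `p ^ (-k)` with `k ≥ 0` exactly when `p ^ k`
divides the numerator and `p` does not divide the denominator. -/
lemma padic_norm_rat_le_zpow_neg_iff {p : ℕ} [hp : Fact p.Prime] (r : ℚ) (k : ℕ) :
    ‖(r : ℚ_[p])‖ ≤ (p : ℝ) ^ (-(k : ℤ)) ↔ p ^ k ∣ r.num.natAbs ∧ ¬ p ∣ r.den := by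
  have hr : ‖(r : ℚ_[p])‖ = ‖(r.num : ℚ_[p])‖ / ‖(r.den : ℚ_[p])‖ := by
    rw [← norm_div]
    conv_lhs => rw [← Rat.num_div_den r]
    push_cast
    rfl
  by_cases hd : p ∣ r.den
  · simp only [hd, not_true, and_false, iff_false, not_le]
    have hn : ‖(r.num : ℚ_[p])‖ = 1 := by
      refine le_antisymm (Padic.norm_int_le_one _) (not_lt.1 fun h => ?_)
      rw [Padic.norm_intCast_lt_one_iff] at h
      have h' : p ∣ r.num.natAbs := Int.natCast_dvd.1 h
      exact hp.out.one_lt.ne' (Nat.eq_one_of_dvd_coprimes r.reduced h' hd)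
    have hd0 : 0 < ‖(r.den : ℚ_[p])‖ := norm_pos_iff.2 (by exact_mod_cast r.den_nz)
    have hd1 : ‖(r.den : ℚ_[p])‖ < 1 := by
      have := (Padic.norm_intCast_lt_one_iff (p := p) (k := (r.den : ℤ))).2
        (by exact_mod_cast hd)
      simpa using this
    rw [hr, hn]
    refine lt_of_le_of_lt ?_ ((one_lt_div hd0).2 hd1)
    exact zpow_le_one_of_nonpos₀ (by exact_mod_cast hp.out.one_lt.le) (by simp)
  · have hn : ‖(r.den : ℚ_[p])‖ = 1 :=
      Padic.norm_natCast_eq_one_iff.2 ((Nat.Prime.coprime_iff_not_dvd hp.out).2 hd)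
    rw [hr, hn, div_one, Padic.norm_int_le_pow_iff_dvd]
    simp only [hd, not_false_eq_true, and_true]
    rw [← Int.natCast_dvd, Nat.cast_pow]

open Finset in
lemma card_coprime_pairs_dvd_left {p : ℕ} (hp : p.Prime) (k T : ℕ) :
    #{z ∈ Ioc 0 T ×ˢ Ioc 0 T | z.1.Coprime z.2 ∧ p ^ k ∣ z.1 ∧ ¬ p ∣ z.2} =
      #{z ∈ Ioc 0 (T / p ^ k) ×ˢ Ioc 0 T | z.1.Coprime z.2 ∧ ¬ p ∣ z.2} := by
  have hpk : 0 < p ^ k := pow_pos hp.pos k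
  symm
  refine card_bij (fun z _ => (p ^ k * z.1, z.2)) ?_ ?_ ?_
  · rintro ⟨m, n⟩ h
    simp only [mem_filter, mem_product, mem_Ioc] at h ⊢
    obtain ⟨⟨⟨h1, h2⟩, h3⟩, h4, h5⟩ := h
    refine ⟨⟨⟨by positivity, ?_⟩, h3⟩, ?_, dvd_mul_right _ _, h5⟩
    · rw [mul_comm]
      exact (Nat.le_div_iff_mul_le hpk).1 h2
    · exact Nat.Coprime.mul_left
        (((Nat.Prime.coprime_iff_not_dvd hp).2 h5).pow_left k) h4
  · rintro ⟨m, n⟩ - ⟨m', n'⟩ - h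
    simp only [Prod.mk.injEq] at h
    exact Prod.ext (Nat.eq_of_mul_eq_mul_left hpk h.1) h.2
  · rintro ⟨m, n⟩ h
    simp only [mem_filter, mem_product, mem_Ioc] at h
    obtain ⟨⟨⟨h1, h2⟩, h3⟩, h4, ⟨m', rfl⟩, h5⟩ := h
    refine ⟨(m', n), ?_, rfl⟩
    simp only [mem_filter, mem_product, mem_Ioc]
    refine ⟨⟨⟨Nat.pos_of_mul_pos_left h1, ?_⟩, h3⟩, h4.coprime_mul_left, h5⟩
    rw [Nat.le_div_iff_mul_le hpk, mul_comm]
    exact h2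

open Filter Topology Finset in
lemma tendsto_const_add_two_mul_div_sq (c : ℝ) {u : ℕ → ℝ} {l : ℝ}
    (h : Tendsto (fun T : ℕ => u T / (T : ℝ) ^ 2) atTop (𝓝 l)) :
    Tendsto (fun T : ℕ => (c + 2 * u T) / (T : ℝ) ^ 2) atTop (𝓝 (2 * l)) := by
  have h1 : Tendsto (fun T : ℕ => c / (T : ℝ) ^ 2) atTop (𝓝 0) :=
    tendsto_const_nhds.div_atTop
      ((tendsto_pow_atTop two_ne_zero).comp tendsto_natCast_atTop_atTop)
  have h2 := h1.add (h.const_mul 2)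
  rw [zero_add] at h2
  refine h2.congr fun T => ?_
  ring

/-- For a prime `p`, `x ∈ ℚ_p` and `e ∈ ℤ` with `e ≥ 0` and `e ≤ v_p(x)`
(the latter automatic for `x = 0`), the proportion of rationals of height at
most `T` lying in the closed ball `B(x, p^{-e})` tends to `p^{1-e}/(p+1)`. -/
theorem ball_height_measure_of_nonneg_le_val
    (p : ℕ) [hp : Fact p.Prime] (x : ℚ_[p]) (e : ℤ)
    (he : 0 ≤ e) (hev : x = 0 ∨ e ≤ x.valuation) :
    Filter.Tendsto
      (fun T : ℕ =>
        (Nat.card {r : ℚ // ratHeight r ≤ T ∧ ‖(r : ℚ_[p]) - x‖ ≤ (p : ℝ) ^ (-e)} : ℝ) /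
        (Nat.card {r : ℚ // ratHeight r ≤ T} : ℝ))
      Filter.atTop (nhds ((p : ℝ) ^ (1 - e) / ((p : ℝ) + 1))) := by
  obtain ⟨k, rfl⟩ := Int.eq_ofNat_of_zero_le he
  have hp1 : (1 : ℝ) < p := by exact_mod_cast hp.out.one_lt
  have hp0 : (0 : ℝ) < p := by linarith
  have hx : ‖x‖ ≤ (p : ℝ) ^ (-(k : ℤ)) := by
    rcases eq_or_ne x 0 with rfl | hx0
    · rw [norm_zero]
      positivity
    · rw [Padic.norm_eq_zpow_neg_valuation hx0]
      exact zpow_le_zpow_right₀ hp1.le (neg_le_neg (hev.resolve_left hx0))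
  have hball : ∀ r : ℚ, ‖(r : ℚ_[p]) - x‖ ≤ (p : ℝ) ^ (-(k : ℤ)) ↔
      p ^ k ∣ r.num.natAbs ∧ ¬ p ∣ r.den := by
    intro r
    rw [← padic_norm_rat_le_zpow_neg_iff]
    constructor
    · intro h
      have h1 := Padic.nonarchimedean ((r : ℚ_[p]) - x) x
      rw [sub_add_cancel] at h1
      exact h1.trans (max_le h hx)
    · intro h
      have h1 := Padic.nonarchimedean (r : ℚ_[p]) (-x)
      rw [← sub_eq_add_neg, norm_neg] at h1
      exact h1.trans (max_le h hx)
  set M := ∑' d : ℕ, (ArithmeticFunction.moebius d : ℝ) / (d : ℝ) ^ 2 with hM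
  set M' := ∑' d : ℕ, if p ∣ d then 0 else (ArithmeticFunction.moebius d : ℝ) / (d : ℝ) ^ 2
    with hM'
  have hMM' : M = (1 - 1 / (p : ℝ) ^ 2) * M' := tsum_moebius_div_sq_eq_mul hp.out
  have hM0 : M ≠ 0 := tsum_moebius_div_sq_ne_zero
  have hM'0 : M' ≠ 0 := fun h => hM0 (by rw [hMM', h, mul_zero])
  have hall := tendsto_card_coprime_pairs 1 (fun _ => True) (fun d => 1 / (d : ℝ)) (fun d _ => by
    simpa [Nat.Ioc_filter_dvd_card_eq_div] using tendsto_natCast_div_div d)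
  have hsub := tendsto_card_coprime_pairs (p ^ k) (fun n => ¬ p ∣ n) _
    (fun d _ => tendsto_card_dvd_and_not_dvd hp.out d)
  have hlim1 : (∑' d : ℕ, (ArithmeticFunction.moebius d : ℝ) *
      ((1 / ((1 * d : ℕ) : ℝ)) * (1 / (d : ℝ)))) = M := by
    refine tsum_congr fun d => ?_
    rw [one_mul]
    ring
  have hlim2 : (∑' d : ℕ, (ArithmeticFunction.moebius d : ℝ) *
      ((1 / ((p ^ k * d : ℕ) : ℝ)) * (if p ∣ d then 0 else (1 / (d : ℝ)) * (1 - 1 / p)))) =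
      ((1 - 1 / p) / (p : ℝ) ^ k) * M' := by
    rw [hM', ← tsum_mul_left]
    refine tsum_congr fun d => ?_
    split_ifs
    · simp
    · push_cast
      rw [one_div (_ * _), mul_inv]
      ring
  rw [hlim1] at hall
  rw [hlim2] at hsub
  have hquot := (tendsto_const_add_two_mul_div_sq
    (if p ^ k ∣ 0 ∧ ¬ p ∣ 1 then 1 else 0) hsub).div
    (tendsto_const_add_two_mul_div_sq 1 hall) (mul_ne_zero two_ne_zero hM0)
  have hval : 2 * (((1 - 1 / p) / (p : ℝ) ^ k) * M') / (2 * M) =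
      (p : ℝ) ^ (1 - (k : ℤ)) / ((p : ℝ) + 1) := by
    have hp2 : (p : ℝ) ^ 2 - 1 ≠ 0 := by nlinarith
    have hp3 : (p : ℝ) - 1 ≠ 0 := by linarith
    rw [hMM', zpow_sub₀ hp0.ne', zpow_one, zpow_natCast]
    have : 1 - 1 / (p : ℝ) ^ 2 = ((p : ℝ) - 1) * (p + 1) / p ^ 2 := by
      field_simp
      ring
    rw [this]
    field_simp
  rw [hval] at hquot
  refine hquot.congr' ?_
  filter_upwards [Filter.eventually_gt_atTop 0] with T hT
  have hT' : (T : ℝ) ^ 2 ≠ 0 := by positivity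
  have hA := card_ratHeight_le_and (fun m n => p ^ k ∣ m ∧ ¬ p ∣ n) hT
  have hB := card_ratHeight_le_and (fun _ _ => True) hT
  rw [card_coprime_pairs_dvd_left hp.out] at hA
  simp only [hball, hA]
  simp only [and_true, if_true] at hB
  simp only [hB, Pi.div_apply, Nat.div_one, and_true]
  rw [div_div_div_cancel_right₀ hT']
  push_cast
  rfl
end

section
/- Let p be a prime, x ∈ ℚ_p, and e ∈ ℤ with e ≤ 0 and e ≤ v_p(x) (the latter automatically holds when x = 0). Then the p-adic ball B(x, p^{-e}) is μ-measurable with height measure μ(B(x, p^{-e})) = 1 − p^{e}/(p+1); that is, the ratio #{r ∈ ℚ : H(r) ≤ T and |r − x|_p ≤ p^{-e}} / #{r ∈ ℚ : H(r) ≤ T} tends to 1 − p^{e}/(p+1) as T → ∞. -/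
namespace RatHeight

open Filter Topology Finset

theorem sum_divisors_moebius (n : ℕ) :
    ∑ d ∈ n.divisors, ArithmeticFunction.moebius d = if n = 1 then 1 else 0 := by
  rw [← ArithmeticFunction.one_apply, ← ArithmeticFunction.coe_zeta_mul_moebius,
    ArithmeticFunction.coe_zeta_mul_apply]

theorem card_filter_dvd_Icc_neg (T d : ℕ) (hd : 0 < d) :
    #{m ∈ Icc (-(T : ℤ)) T | d ∣ m.natAbs} = 2 * (T / d) + 1 := by
  have h : {m ∈ Icc (-(T : ℤ)) T | d ∣ m.natAbs} =
      (Icc (-((T / d : ℕ) : ℤ)) ((T / d : ℕ) : ℤ)).image (fun k => (d : ℤ) * k) := by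
    have hd' : (0 : ℤ) < d := by exact_mod_cast hd
    ext m
    simp only [mem_filter, mem_Icc, mem_image]
    constructor
    · rintro ⟨⟨h1, h2⟩, h3⟩
      obtain ⟨k, rfl⟩ := Int.natCast_dvd.2 h3
      refine ⟨k, ⟨?_, ?_⟩, rfl⟩
      · have : -k ≤ (T : ℤ) / d := (Int.le_ediv_iff_mul_le hd').2 (by linarith)
        push_cast; linarith
      · push_cast
        exact (Int.le_ediv_iff_mul_le hd').2 (by linarith)
    · rintro ⟨k, ⟨h1, h2⟩, rfl⟩
      push_cast at h1 h2
      have h1' : -k ≤ (T : ℤ) / d := by linarith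
      rw [Int.le_ediv_iff_mul_le hd'] at h1' h2
      exact ⟨⟨by linarith, by linarith⟩, Int.natCast_dvd.1 (dvd_mul_right _ _)⟩
  rw [h, card_image_of_injective _ (mul_right_injective₀ (by exact_mod_cast hd.ne')), Int.card_Icc]
  omega

/-- Rationals of height at most `T` with denominator divisible by `q` are the coprime pairs
`(m, n)` in a box with `q ∣ n`. -/
theorem card_rat_eq_card_coprime (q T : ℕ) :
    Nat.card {r : ℚ // ratHeight r ≤ T ∧ q ∣ r.den} =
      #{z ∈ Icc (-(T : ℤ)) T ×ˢ Ioc 0 T | z.1.natAbs.gcd z.2 = 1 ∧ q ∣ z.2} := by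
  rw [← Nat.card_eq_finsetCard]
  refine Nat.card_congr
    { toFun := fun r => ⟨(r.1.num, r.1.den), ?_⟩
      invFun := fun z => ⟨⟨z.1.1, z.1.2, ?_, ?_⟩, ?_⟩
      left_inv := fun r => rfl
      right_inv := fun z => rfl }
  · obtain ⟨r, hr, hq⟩ := r
    have h1 := r.den_pos
    simp only [ratHeight, max_le_iff] at hr
    simp only [mem_filter, mem_product, mem_Icc, mem_Ioc]
    exact ⟨⟨by omega, by omega⟩, r.reduced, hq⟩
  all_goals
    obtain ⟨⟨m, n⟩, hz⟩ := z
    simp only [mem_filter, mem_product, mem_Icc, mem_Ioc] at hz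
  · exact hz.1.2.1.ne'
  · exact hz.2.1
  · exact ⟨max_le (by dsimp only; omega) hz.1.2.2, hz.2.2⟩

theorem card_coprime_eq_sum (q T : ℕ) :
    (#{z ∈ Icc (-(T : ℤ)) T ×ˢ Ioc 0 T | z.1.natAbs.gcd z.2 = 1 ∧ q ∣ z.2} : ℤ) =
      ∑ d ∈ Ioc 0 T, ArithmeticFunction.moebius d *
        ((2 * (T / d) + 1 : ℕ) * (T / d.lcm q : ℕ)) := by
  have h1 : ∀ d ∈ Ioc 0 T, ArithmeticFunction.moebius d *
        (((2 * (T / d) + 1 : ℕ) : ℤ) * (T / d.lcm q : ℕ)) =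
      ∑ z ∈ Icc (-(T : ℤ)) T ×ˢ Ioc 0 T,
        if (d ∣ z.1.natAbs) ∧ (d.lcm q ∣ z.2) then ArithmeticFunction.moebius d else 0 := by
    intro d hd
    rw [← card_filter_dvd_Icc_neg T d (mem_Ioc.1 hd).1, ← Nat.Ioc_filter_dvd_card_eq_div,
      ← Nat.cast_mul, ← card_product, ← sum_filter, ← filter_product, sum_const]
    simp [mul_comm]
  rw [sum_congr rfl h1, sum_comm, card_filter]
  push_cast
  refine sum_congr rfl fun z hz => ?_
  simp only [mem_product, mem_Icc, mem_Ioc] at hz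
  by_cases hq : q ∣ z.2
  · simp only [hq, and_true, Nat.lcm_dvd_iff, ← Nat.dvd_gcd_iff]
    rw [← sum_divisors_moebius, ← sum_filter]
    refine sum_congr ?_ fun _ _ => rfl
    ext d
    have h0 : 0 < z.1.natAbs.gcd z.2 := Nat.gcd_pos_of_pos_right _ hz.2.1
    simp only [Nat.mem_divisors, mem_filter, mem_Ioc]
    constructor
    · rintro ⟨h, -⟩
      exact ⟨⟨Nat.pos_of_dvd_of_pos h h0,
        (Nat.le_of_dvd hz.2.1 (h.trans (Nat.gcd_dvd_right _ _))).trans hz.2.2⟩, h⟩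
    · rintro ⟨-, h⟩
      exact ⟨h, h0.ne'⟩
  · simp [hq, Nat.lcm_dvd_iff]

theorem tendsto_nat_div_div (n : ℕ) :
    Tendsto (fun T : ℕ => ((T / n : ℕ) : ℝ) / T) atTop (𝓝 (1 / n)) := by
  have h := (tendsto_nat_floor_mul_div_atTop (R := ℝ) (a := 1 / n) (by positivity)).comp
    tendsto_natCast_atTop_atTop
  refine h.congr fun T => ?_
  simp only [Function.comp]
  rw [← Nat.floor_div_eq_div (K := ℝ), one_div_mul_eq_div]

theorem tendsto_card_div_sq (q : ℕ) (hq : 0 < q) :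
    Tendsto (fun T : ℕ => (Nat.card {r : ℚ // ratHeight r ≤ T ∧ q ∣ r.den} : ℝ) / T ^ 2) atTop
      (𝓝 (∑' d : ℕ, (ArithmeticFunction.moebius d : ℝ) * (2 / d * (1 / (d.lcm q : ℕ))))) := by
  have key : ∀ T : ℕ, (Nat.card {r : ℚ // ratHeight r ≤ T ∧ q ∣ r.den} : ℝ) / T ^ 2 =
      ∑' d : ℕ, (ArithmeticFunction.moebius d : ℝ) *
        ((2 * (((T / d : ℕ) : ℝ) / T) + 1 / T) * (((T / d.lcm q : ℕ) : ℝ) / T)) := by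
    intro T
    rw [tsum_eq_sum (s := Ioc 0 T), card_rat_eq_card_coprime]
    · have := congrArg (Int.cast (R := ℝ)) (card_coprime_eq_sum q T)
      rw [Int.cast_natCast] at this
      rw [this, Int.cast_sum, sum_div]
      refine sum_congr rfl fun d _ => ?_
      rw [Int.cast_mul, Int.cast_mul, Int.cast_natCast, Int.cast_natCast, Nat.cast_add, Nat.cast_mul]
      simp only [Nat.cast_ofNat, Nat.cast_one]
      ring
    · intro d hd
      rcases Nat.eq_zero_or_pos d with rfl | hd0
      · simp
      · have : T < d.lcm q := by
          have h1 : d ≤ d.lcm q := Nat.le_of_dvd (Nat.lcm_pos hd0 hq) (Nat.dvd_lcm_left _ _)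
          simp only [mem_Ioc] at hd
          omega
        simp [Nat.div_eq_of_lt this]
  simp_rw [key]
  refine tendsto_tsum_of_dominated_convergence (bound := fun d : ℕ => 3 * (1 / (d : ℝ) ^ 2))
    ((Real.summable_one_div_nat_pow.2 one_lt_two).mul_left 3) ?_ ?_
  · intro d
    refine Tendsto.const_mul _ (Tendsto.mul ?_ (tendsto_nat_div_div _))
    have := ((tendsto_nat_div_div d).const_mul 2).add tendsto_one_div_atTop_nhds_zero_nat
    convert this using 2
    ring
  · filter_upwards [eventually_gt_atTop 0] with T hT d
    rcases Nat.eq_zero_or_pos d with rfl | hd0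
    · simp
    have hl : d ≤ d.lcm q := Nat.le_of_dvd (Nat.lcm_pos hd0 hq) (Nat.dvd_lcm_left _ _)
    have hT' : (0 : ℝ) < T := by exact_mod_cast hT
    have hd' : (0 : ℝ) < d := by exact_mod_cast hd0
    by_cases hdT : d ≤ T
    · have h1 : ((T / d : ℕ) : ℝ) / T ≤ 1 / d := by
        rw [div_le_div_iff₀ hT' hd', one_mul]
        exact_mod_cast Nat.div_mul_le_self T d
      have h2 : ((T / d.lcm q : ℕ) : ℝ) / T ≤ 1 / d := by
        refine le_trans ?_ h1
        gcongr
      have h3 : (1 : ℝ) / T ≤ 1 / d := by gcongr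
      have hm : |(ArithmeticFunction.moebius d : ℝ)| ≤ 1 := by
        exact_mod_cast ArithmeticFunction.abs_moebius_le_one (n := d)
      rw [norm_mul, Real.norm_eq_abs, Real.norm_of_nonneg (by positivity)]
      calc _ ≤ 1 * ((2 * (1 / d) + 1 / d) * (1 / (d : ℝ))) := by gcongr
        _ = _ := by ring
    · rw [Nat.div_eq_of_lt (show T < d.lcm q by omega)]
      simp only [Nat.cast_zero, zero_div, mul_zero, norm_zero]
      positivity

theorem tsum_moebius_div_sq_ne_zero :
    ∑' d : ℕ, (ArithmeticFunction.moebius d : ℝ) / d ^ 2 ≠ 0 := by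
  intro h
  have h2 := LSeries_one_mul_Lseries_moebius (s := 2) (by simp)
  have h3 : LSeries (fun n => ((ArithmeticFunction.moebius n : ℤ) : ℂ)) 2 =
      ((∑' d : ℕ, (ArithmeticFunction.moebius d : ℝ) / d ^ 2 : ℝ) : ℂ) := by
    rw [LSeries, Complex.ofReal_tsum]
    refine tsum_congr fun n => ?_
    rcases Nat.eq_zero_or_pos n with rfl | hn
    · simp
    · rw [LSeries.term_of_ne_zero hn.ne']
      push_cast
      norm_cast
  rw [h3, h] at h2
  simp at h2

theorem moebius_prime_mul {p : ℕ} (hp : p.Prime) (n : ℕ) :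
    ArithmeticFunction.moebius (p * n) = if p ∣ n then 0 else -ArithmeticFunction.moebius n := by
  split_ifs with h
  · obtain ⟨k, rfl⟩ := h
    refine ArithmeticFunction.moebius_eq_zero_of_not_squarefree fun hs => hp.not_isUnit ?_
    exact hs p ⟨k, by ring⟩
  · rw [ArithmeticFunction.isMultiplicative_moebius.map_mul_of_coprime
      ((Nat.Prime.coprime_iff_not_dvd hp).2 h), ArithmeticFunction.moebius_apply_prime hp]
    ring

theorem summable_ite_moebius_div_sq (P : ℕ → Prop) [DecidablePred P] :
    Summable fun d : ℕ => if P d then (ArithmeticFunction.moebius d : ℝ) / d ^ 2 else 0 := by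
  refine Summable.of_norm_bounded (Real.summable_one_div_nat_pow.2 one_lt_two) fun d => ?_
  split_ifs
  · have hm : |(ArithmeticFunction.moebius d : ℝ)| ≤ 1 := by
      exact_mod_cast ArithmeticFunction.abs_moebius_le_one (n := d)
    rw [norm_div, Real.norm_eq_abs, norm_pow, Real.norm_natCast]
    gcongr
  · rw [norm_zero]; positivity

theorem tsum_dvd_moebius_div_sq {p : ℕ} (hp : p.Prime) :
    (∑' d : ℕ, if p ∣ d then (ArithmeticFunction.moebius d : ℝ) / d ^ 2 else 0) =
      -(1 / (p : ℝ) ^ 2) *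
        ∑' d : ℕ, if ¬ p ∣ d then (ArithmeticFunction.moebius d : ℝ) / d ^ 2 else 0 := by
  have hinj : Function.Injective (fun d : ℕ => p * d) := mul_right_injective₀ hp.ne_zero
  rw [← hinj.tsum_eq, ← tsum_mul_left]
  · refine tsum_congr fun d => ?_
    simp only [dvd_mul_right, if_true, moebius_prime_mul hp]
    split_ifs
    · simp
    · push_cast
      rw [mul_pow]
      ring
  · intro d hd
    by_contra hc
    refine hd (if_neg fun ⟨k, hk⟩ => hc ⟨k, hk.symm⟩)

theorem moebius_mul_lcm_prime_pow {p : ℕ} (hp : p.Prime) (k d : ℕ) :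
    (ArithmeticFunction.moebius d : ℝ) * (2 / d * (1 / (d.lcm (p ^ (k + 1)) : ℕ))) =
      2 / (p : ℝ) ^ (k + 1) *
          (if ¬ p ∣ d then (ArithmeticFunction.moebius d : ℝ) / d ^ 2 else 0) +
        2 / (p : ℝ) ^ k *
          (if p ∣ d then (ArithmeticFunction.moebius d : ℝ) / d ^ 2 else 0) := by
  have hp0 : (p : ℝ) ≠ 0 := by exact_mod_cast hp.ne_zero
  by_cases h : p ∣ d
  · simp only [h, not_true, if_true, if_false, mul_zero, zero_add]
    obtain ⟨n, rfl⟩ := h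
    by_cases hn : p ∣ n
    · simp [moebius_prime_mul hp, hn]
    · have : (p * n).lcm (p ^ (k + 1)) = p * n * p ^ k := by
        rw [pow_succ', Nat.lcm_mul_left, mul_assoc]
        congr 1
        exact Nat.Coprime.lcm_eq_mul (((Nat.Prime.coprime_iff_not_dvd hp).2 hn).pow_left k).symm
      rw [this]
      push_cast
      field_simp
  · have : d.lcm (p ^ (k + 1)) = d * p ^ (k + 1) :=
      Nat.Coprime.lcm_eq_mul (((Nat.Prime.coprime_iff_not_dvd hp).2 h).pow_left _).symm
    simp only [h, not_false_eq_true, if_true, if_false, mul_zero, add_zero]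
    rw [this]
    push_cast
    field_simp

theorem tendsto_ratio {p : ℕ} (hp : p.Prime) (k : ℕ) :
    Tendsto (fun T : ℕ => (Nat.card {r : ℚ // ratHeight r ≤ T ∧ p ^ (k + 1) ∣ r.den} : ℝ) /
      (Nat.card {r : ℚ // ratHeight r ≤ T} : ℝ)) atTop (𝓝 (1 / (p : ℝ) ^ k / (p + 1))) := by
  set A := ∑' d : ℕ, if ¬ p ∣ d then (ArithmeticFunction.moebius d : ℝ) / d ^ 2 else 0
  have hp1 : (1 : ℝ) < p := by exact_mod_cast hp.one_lt
  have hsA := summable_ite_moebius_div_sq (fun d => ¬ p ∣ d)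
  have hsB := summable_ite_moebius_div_sq (fun d => p ∣ d)
  have hB := tsum_dvd_moebius_div_sq hp
  have hS : ∑' d : ℕ, (ArithmeticFunction.moebius d : ℝ) / d ^ 2 = (1 - 1 / (p : ℝ) ^ 2) * A := by
    calc _ = _ := tsum_congr fun d => ?_
      _ = _ := hsA.tsum_add hsB
      _ = _ := by rw [hB]; ring
    by_cases h : p ∣ d <;> simp [h]
  have hA0 : A ≠ 0 := fun h => tsum_moebius_div_sq_ne_zero (by rw [hS, h, mul_zero])
  have h1 := tendsto_card_div_sq 1 one_pos
  have h2 := tendsto_card_div_sq (p ^ (k + 1)) (pow_pos hp.pos _)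
  have e1 : ∑' d : ℕ, (ArithmeticFunction.moebius d : ℝ) * (2 / d * (1 / (d.lcm 1 : ℕ))) =
      2 * ((1 - 1 / (p : ℝ) ^ 2) * A) := by
    rw [← hS, ← tsum_mul_left]
    refine tsum_congr fun d => ?_
    rw [Nat.lcm_one_right]
    ring
  have e2 : ∑' d : ℕ, (ArithmeticFunction.moebius d : ℝ) *
      (2 / d * (1 / (d.lcm (p ^ (k + 1)) : ℕ))) =
      2 / (p : ℝ) ^ (k + 1) * A + 2 / (p : ℝ) ^ k * (-(1 / (p : ℝ) ^ 2) * A) := by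
    rw [tsum_congr (moebius_mul_lcm_prime_pow hp k),
      (hsA.mul_left _).tsum_add (hsB.mul_left _), tsum_mul_left, tsum_mul_left, hB]
  rw [e1] at h1
  rw [e2] at h2
  have hpp : 1 - 1 / (p : ℝ) ^ 2 ≠ 0 := by
    have : 1 / (p : ℝ) ^ 2 < 1 := by
      rw [div_lt_one (by positivity)]
      nlinarith
    linarith
  have h3 := h2.div h1 (by positivity)
  have e3 : (2 / (p : ℝ) ^ (k + 1) * A + 2 / (p : ℝ) ^ k * (-(1 / (p : ℝ) ^ 2) * A)) /
      (2 * ((1 - 1 / (p : ℝ) ^ 2) * A)) = 1 / (p : ℝ) ^ k / (p + 1) := by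
    have : (p : ℝ) ^ 2 - 1 ≠ 0 := by nlinarith
    have : (p : ℝ) - 1 ≠ 0 := by linarith
    rw [div_div, div_eq_div_iff (by positivity) (by positivity)]
    field_simp
    ring
  rw [e3] at h3
  refine h3.congr' ?_
  filter_upwards [eventually_gt_atTop 0] with T hT
  have hT' : (T : ℝ) ^ 2 ≠ 0 := by positivity
  simp only [Pi.div_apply, one_dvd, and_true]
  exact div_div_div_cancel_right₀ hT' _ _

theorem finite_ratHeight_le (T : ℕ) : {r : ℚ | ratHeight r ≤ T}.Finite := by
  refine Set.Finite.of_finite_image (f := fun r : ℚ => (r.num, r.den))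
    (((Icc (-(T : ℤ)) T) ×ˢ Icc 0 T).finite_toSet.subset ?_) ?_
  · rintro _ ⟨r, hr, rfl⟩
    simp only [ratHeight, Set.mem_ofPred_eq, max_le_iff] at hr
    simp only [coe_product, coe_Icc, Set.mem_prod, Set.mem_Icc]
    omega
  · intro r _ s _ h
    simp only [Prod.mk.injEq] at h
    exact Rat.ext h.1 h.2

theorem norm_le_pow_iff_not_dvd_den (p : ℕ) [hp : Fact p.Prime] (r : ℚ) (k : ℕ) :
    ‖(r : ℚ_[p])‖ ≤ (p : ℝ) ^ k ↔ ¬ p ^ (k + 1) ∣ r.den := by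
  have hp0 : (0 : ℝ) < p := by exact_mod_cast hp.out.pos
  have hr : ‖(r : ℚ_[p])‖ = ‖(r.num : ℚ_[p])‖ / ‖(r.den : ℚ_[p])‖ := by
    rw [← norm_div, ← Rat.cast_def]
  have hden : (0 : ℝ) < ‖(r.den : ℚ_[p])‖ := norm_pos_iff.2 (by exact_mod_cast r.den_nz)
  have hdvd : ∀ n : ℕ, ‖(r.den : ℚ_[p])‖ ≤ (p : ℝ) ^ (-n : ℤ) ↔ p ^ n ∣ r.den := by
    intro n
    have := Padic.norm_int_le_pow_iff_dvd (p := p) (r.den : ℤ) n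
    rw [Int.cast_natCast] at this
    rw [this]
    norm_cast
  constructor
  · intro h hd
    have hnum : ‖(r.num : ℚ_[p])‖ = 1 := by
      refine le_antisymm (Padic.norm_int_le_one _) (not_lt.1 fun hlt => ?_)
      rw [Padic.norm_intCast_lt_one_iff] at hlt
      have h1 : p ∣ r.num.natAbs := Int.natCast_dvd.1 hlt
      have h2 : p ∣ r.den := (dvd_pow_self p k.succ_ne_zero).trans hd
      exact Nat.not_coprime_of_dvd_of_dvd hp.out.one_lt h1 h2 r.reduced
    rw [← hdvd] at hd
    rw [hr, hnum, div_le_iff₀ hden] at h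
    have : (1 : ℝ) ≤ (p : ℝ) ^ k * (p : ℝ) ^ (-(k + 1 : ℕ) : ℤ) :=
      h.trans (by gcongr)
    rw [zpow_neg, zpow_natCast, pow_succ, mul_inv, ← mul_assoc, mul_inv_cancel₀ (by positivity),
      one_mul] at this
    have h1 : (1 : ℝ) < p := by exact_mod_cast hp.out.one_lt
    exact absurd this (not_le.2 (inv_lt_one_of_one_lt₀ h1))
  · intro h
    rw [← hdvd, Padic.norm_le_pow_iff_norm_lt_pow_add_one] at h
    have h' : (p : ℝ) ^ (-k : ℤ) ≤ ‖(r.den : ℚ_[p])‖ := by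
      have := not_lt.1 h
      rwa [show (-((k + 1 : ℕ) : ℤ) + 1) = -k by push_cast; ring] at this
    rw [hr, div_le_iff₀ hden]
    refine (Padic.norm_int_le_one _).trans ?_
    rw [zpow_neg, zpow_natCast] at h'
    calc (1 : ℝ) = (p : ℝ) ^ k * ((p : ℝ) ^ k)⁻¹ := (mul_inv_cancel₀ (by positivity)).symm
      _ ≤ _ := by gcongr

theorem norm_sub_le_iff_norm_le (p : ℕ) [Fact p.Prime] {x y : ℚ_[p]} {R : ℝ} (hx : ‖x‖ ≤ R) :
    ‖y - x‖ ≤ R ↔ ‖y‖ ≤ R := by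
  constructor <;> intro h
  · have := Padic.nonarchimedean (y - x) x
    rw [sub_add_cancel] at this
    exact this.trans (max_le h hx)
  · have := Padic.nonarchimedean y (-x)
    rw [norm_neg, ← sub_eq_add_neg] at this
    exact this.trans (max_le h hx)

end RatHeight

/-- For a prime `p`, `x ∈ ℚ_p` and `e ∈ ℤ` with `e ≤ 0` and `e ≤ v_p(x)`
(the latter automatic for `x = 0`), the proportion of rationals of height at
most `T` lying in the closed ball `B(x, p^{-e})` tends to `1 - p^e/(p+1)`. -/
theorem ball_height_measure_of_nonpos_le_val
    (p : ℕ) [hp : Fact p.Prime] (x : ℚ_[p]) (e : ℤ)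
    (he : e ≤ 0) (hev : x = 0 ∨ e ≤ x.valuation) :
    Filter.Tendsto
      (fun T : ℕ =>
        (Nat.card {r : ℚ // ratHeight r ≤ T ∧ ‖(r : ℚ_[p]) - x‖ ≤ (p : ℝ) ^ (-e)} : ℝ) /
        (Nat.card {r : ℚ // ratHeight r ≤ T} : ℝ))
      Filter.atTop (nhds (1 - (p : ℝ) ^ e / ((p : ℝ) + 1))) := by
  obtain ⟨k, hk⟩ := Int.eq_ofNat_of_zero_le (show 0 ≤ -e by omega)
  have hp1 : (1 : ℝ) < p := by exact_mod_cast hp.out.one_lt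
  have hx : ‖x‖ ≤ (p : ℝ) ^ k := by
    rcases eq_or_ne x 0 with rfl | h0
    · rw [norm_zero]; positivity
    · rw [Padic.norm_eq_zpow_neg_valuation h0, ← zpow_natCast]
      exact zpow_le_zpow_right₀ hp1.le (by have := hev.resolve_left h0; omega)
  have he' : (p : ℝ) ^ e = 1 / (p : ℝ) ^ k := by
    rw [show e = -(k : ℤ) by omega, zpow_neg, zpow_natCast, one_div]
  rw [he', hk]
  simp only [zpow_natCast, RatHeight.norm_sub_le_iff_norm_le p hx,
    RatHeight.norm_le_pow_iff_not_dvd_den]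
  refine ((RatHeight.tendsto_ratio hp.out k).const_sub 1).congr' ?_
  filter_upwards [Filter.eventually_ge_atTop 1] with T hT
  have hfin := RatHeight.finite_ratHeight_le T
  have hsum : Nat.card {r : ℚ // ratHeight r ≤ T ∧ p ^ (k + 1) ∣ r.den} +
      Nat.card {r : ℚ // ratHeight r ≤ T ∧ ¬ p ^ (k + 1) ∣ r.den} =
      Nat.card {r : ℚ // ratHeight r ≤ T} :=
    Set.ncard_inter_add_ncard_sdiff_eq_ncard {r : ℚ | ratHeight r ≤ T}
      {r : ℚ | p ^ (k + 1) ∣ r.den} hfin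
  have hpos : (Nat.card {r : ℚ // ratHeight r ≤ T} : ℝ) ≠ 0 := by
    have : Nonempty {r : ℚ // ratHeight r ≤ T} := ⟨0, by simpa [ratHeight] using hT⟩
    have : Finite {r : ℚ // ratHeight r ≤ T} := hfin
    exact_mod_cast Nat.card_pos.ne'
  rw [← hsum] at hpos ⊢
  push_cast at hpos ⊢
  field_simp
  ring
end

section
/- Let p be a prime, x ∈ ℚ_p nonzero, and e ∈ ℤ with v_p(x) < e < −1. Then the p-adic sphere {r ∈ ℚ_p : v_p(r − x) = e} has height measure (p^{-e}/|x|_p^2) · (p−1)/(p+1) = p^{2 v_p(x) − e} (p−1)/(p+1); that is, the ratio #{r ∈ ℚ : H(r) ≤ T and v_p(r − x) = e} / #{r ∈ ℚ : H(r) ≤ T} tends to this value as T → ∞. -/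
section PadicSpheres

variable {p : ℕ} [hp : Fact p.Prime]

lemma Padic.norm_inv_sub_inv_of_norm_sub_lt {r x : ℚ_[p]} (h : ‖r - x‖ < ‖x‖) :
    ‖r⁻¹ - x⁻¹‖ = ‖r - x‖ / ‖x‖ ^ 2 := by
  have hrx : ‖r‖ = ‖x‖ := Padic.norm_eq_of_norm_sub_lt_right h
  have hx : x ≠ 0 := norm_pos_iff.1 ((norm_nonneg _).trans_lt h)
  have hr : r ≠ 0 := norm_pos_iff.1 (hrx ▸ norm_pos_iff.2 hx)
  rw [inv_sub_inv hr hx, norm_div, norm_mul, hrx, norm_sub_rev, sq]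

lemma Padic.norm_sub_eq_iff_of_norm_sub_lt {z y w : ℚ_[p]} {ρ : ℝ} (h : ‖y - w‖ < ρ) :
    ‖z - y‖ = ρ ↔ ‖z - w‖ = ρ := by
  constructor <;> intro hz
  · rw [← hz]
    refine (Padic.norm_eq_of_norm_sub_lt_left ?_).symm
    rw [hz, norm_sub_rev]
    simpa using h
  · rw [← hz]
    refine (Padic.norm_eq_of_norm_sub_lt_left ?_).symm
    rw [hz]
    simpa using h

lemma Padic.exists_int_norm_sub_le {y : ℚ_[p]} (hy : ‖y‖ ≤ 1) (N : ℕ) :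
    ∃ a : ℤ, ‖y - a‖ ≤ (p : ℝ) ^ (-N : ℤ) := by
  refine ⟨(PadicInt.appr (⟨y, hy⟩ : ℤ_[p]) N : ℕ), ?_⟩
  have h := (PadicInt.norm_le_pow_iff_mem_span_pow _ N).2 (PadicInt.appr_spec N ⟨y, hy⟩)
  rw [PadicInt.norm_def] at h
  push_cast at h ⊢
  exact h

lemma Padic.norm_intCast_eq_zpow_neg_iff (k : ℤ) (n : ℕ) :
    ‖(k : ℚ_[p])‖ = (p : ℝ) ^ (-n : ℤ) ↔ (p : ℤ) ^ n ∣ k ∧ ¬ (p : ℤ) ^ (n + 1) ∣ k := by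
  have h1 := Padic.norm_int_le_pow_iff_dvd (p := p) k n
  have h2 := Padic.norm_int_le_pow_iff_dvd (p := p) k (n + 1)
  have h3 := Padic.norm_le_pow_iff_norm_lt_pow_add_one (k : ℚ_[p]) (-(n + 1 : ℕ) : ℤ)
  rw [show (-(n + 1 : ℕ) : ℤ) + 1 = -n by push_cast; ring] at h3
  push_cast at h1 h2 h3
  rw [← h1, ← h2, h3, not_lt, le_antisymm_iff]

lemma Padic.norm_sub_eq_iff_num_den {x : ℚ_[p]} (hx : x ≠ 0) {e : ℤ}
    (hve : x.valuation < e) (hv : x.valuation < 0) {s : ℕ} (hs : (s : ℤ) = e - 2 * x.valuation)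
    {a : ℤ} (ha : ‖x⁻¹ - a‖ ≤ (p : ℝ) ^ (-(s + 1 : ℕ) : ℤ)) (r : ℚ) :
    ‖(r : ℚ_[p]) - x‖ = (p : ℝ) ^ (-e) ↔
      ¬ (p : ℤ) ∣ r.num ∧ (p : ℤ) ^ s ∣ r.den - a * r.num ∧
        ¬ (p : ℤ) ^ (s + 1) ∣ r.den - a * r.num := by
  have hp1 : (1 : ℝ) < p := mod_cast hp.out.one_lt
  have hp0 : (p : ℝ) ≠ 0 := by positivity
  have hnx : ‖x‖ = (p : ℝ) ^ (-x.valuation) := Padic.norm_eq_zpow_neg_valuation hx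
  have hny : ‖x⁻¹‖ = (p : ℝ) ^ x.valuation := by rw [norm_inv, hnx, ← zpow_neg, neg_neg]
  have hmp : ¬ (p : ℤ) ∣ r.num → ‖(r.num : ℚ_[p])‖ = 1 := fun h =>
    ((Padic.norm_int_le_one _).antisymm (not_lt.1 (mt Padic.norm_intCast_lt_one_iff.1 h)))
  have key : ‖(r : ℚ_[p]) - x‖ = (p : ℝ) ^ (-e) ↔ ‖(r : ℚ_[p])⁻¹ - x⁻¹‖ = (p : ℝ) ^ (-s : ℤ) := by
    constructor <;> intro h
    · rw [Padic.norm_inv_sub_inv_of_norm_sub_lt, h, hnx, ← zpow_natCast, ← zpow_mul,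
        ← zpow_sub₀ hp0, hs]
      · congr 1; push_cast; ring
      · rw [h, hnx]; exact zpow_lt_zpow_right₀ hp1 (by lia)
    · have := Padic.norm_inv_sub_inv_of_norm_sub_lt (r := (r : ℚ_[p])⁻¹) (x := x⁻¹) (by
        rw [h, hny]; exact zpow_lt_zpow_right₀ hp1 (by lia))
      rw [inv_inv, inv_inv] at this
      rw [this, h, hny, ← zpow_natCast, ← zpow_mul, ← zpow_sub₀ hp0, hs]
      congr 1; push_cast; ring
  have hlt : ‖x⁻¹ - a‖ < (p : ℝ) ^ (-s : ℤ) :=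
    ha.trans_lt (zpow_lt_zpow_right₀ hp1 (by push_cast; lia))
  have hmul : (r.num : ℚ_[p]) ≠ 0 →
      (((r.den - a * r.num : ℤ)) : ℚ_[p]) = r.num * ((r : ℚ_[p])⁻¹ - a) := by
    intro h
    have hd : (r.den : ℚ_[p]) ≠ 0 := mod_cast r.den_nz
    rw [Rat.cast_def]
    push_cast
    field_simp
  rw [key, Padic.norm_sub_eq_iff_of_norm_sub_lt hlt, ← Padic.norm_intCast_eq_zpow_neg_iff]
  constructor
  · intro h
    have hm : ¬ (p : ℤ) ∣ r.num := by
      intro hpm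
      have h' := (Padic.norm_sub_eq_iff_of_norm_sub_lt hlt).2 h
      have h1 : ‖(r : ℚ_[p])⁻¹‖ = ‖x⁻¹‖ := Padic.norm_eq_of_norm_sub_lt_right (by
        rw [h', hny]; exact zpow_lt_zpow_right₀ hp1 (by lia))
      have hlt1 : ‖(r : ℚ_[p])⁻¹‖ < 1 := by
        rw [h1, hny]; exact zpow_lt_one_of_neg₀ hp1 hv
      have hpd : ¬ p ∣ r.den := fun hd => by
        have := Nat.dvd_gcd (Int.natCast_dvd.1 hpm) hd
        rw [r.reduced] at this
        exact hp.out.one_lt.ne' (Nat.dvd_one.1 this)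
      have hle := Padic.norm_rat_le_one hpd
      rw [norm_inv] at hlt1
      have hr0 : 0 < ‖(r : ℚ_[p])‖ := by
        have : 0 < ‖(r : ℚ_[p])⁻¹‖ := by rw [h1]; exact norm_pos_iff.2 (inv_ne_zero hx)
        simpa using this
      exact absurd ((one_le_inv₀ hr0).2 hle) (not_le.2 hlt1)
    have h0 : (r.num : ℚ_[p]) ≠ 0 := norm_pos_iff.1 (by rw [hmp hm]; exact one_pos)
    exact ⟨hm, by rw [hmul h0, norm_mul, hmp hm, one_mul, h]⟩
  · rintro ⟨hm, h⟩
    have h0 : (r.num : ℚ_[p]) ≠ 0 := norm_pos_iff.1 (by rw [hmp hm]; exact one_pos)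
    rwa [hmul h0, norm_mul, hmp hm, one_mul] at h

end PadicSpheres

section BoxCounts

open Finset Filter Topology

open Classical in
/-- The number of pairs `(m, n)` with `|m| ≤ T`, `1 ≤ n ≤ T` satisfying `P m n`. -/
noncomputable def boxCount (P : ℤ → ℕ → Prop) (T : ℕ) : ℕ :=
  #{z ∈ Icc (-T : ℤ) T ×ˢ Icc 1 T | P z.1 z.2}

lemma natCard_ratHeight_le_eq_boxCount (P : ℤ → ℕ → Prop) (T : ℕ) :
    Nat.card {r : ℚ // ratHeight r ≤ T ∧ P r.num r.den} =
      boxCount (fun m n => m.natAbs.Coprime n ∧ P m n) T := by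
  classical
  rw [boxCount, ← Fintype.card_coe, ← Nat.card_eq_fintype_card]
  refine Nat.card_congr
    { toFun := fun r => ⟨(r.1.num, r.1.den), ?_⟩
      invFun := fun z => ⟨⟨z.1.1, z.1.2, ?_, ?_⟩, ?_⟩
      left_inv := fun r => rfl
      right_inv := fun z => rfl }
  · obtain ⟨r, hr, hP⟩ := r
    have := r.den_pos
    simp only [ratHeight, sup_le_iff] at hr
    simp only [mem_filter, mem_product, mem_Icc]
    exact ⟨⟨by lia, by lia⟩, r.reduced, hP⟩
  · have := z.2
    simp only [mem_filter, mem_product, mem_Icc] at this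
    lia
  · have := z.2
    simp only [mem_filter, mem_product, mem_Icc] at this
    exact this.2.1
  · have := z.2
    simp only [mem_filter, mem_product, mem_Icc] at this
    refine ⟨?_, this.2.2⟩
    simp only [ratHeight, sup_le_iff]
    lia

lemma boxCount_le (P : ℤ → ℕ → Prop) (T : ℕ) : (boxCount P T : ℝ) ≤ 3 * (T : ℝ) ^ 2 := by
  classical
  have h : boxCount P T ≤ (2 * T + 1) * T := by
    refine (card_filter_le _ _).trans ?_
    rw [card_product, Int.card_Icc, Nat.card_Icc]
    exact Nat.mul_le_mul (by lia) (by lia)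
  have h' : (2 * T + 1) * T ≤ 3 * T ^ 2 := by
    rcases Nat.eq_zero_or_pos T with rfl | hT
    · simp
    · nlinarith
  exact_mod_cast h.trans h'

lemma boxCount_dvd_eq_boxCount_div {P : ℤ → ℕ → Prop} {d : ℕ} (hd : 0 < d)
    (hP : ∀ m n, P (d * m) (d * n) ↔ P m n) (T : ℕ) :
    boxCount (fun m n => (d ∣ m.natAbs ∧ d ∣ n) ∧ P m n) T = boxCount P (T / d) := by
  classical
  symm
  refine card_bij (fun z _ => ((d : ℤ) * z.1, d * z.2)) ?_ ?_ ?_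
  · rintro ⟨m, n⟩ h
    simp only [mem_filter, mem_product, mem_Icc] at h ⊢
    obtain ⟨⟨⟨h1, h2⟩, h3, h4⟩, h5⟩ := h
    have hT : (d : ℤ) * (T / d : ℕ) ≤ T := mod_cast Nat.mul_div_le T d
    refine ⟨⟨⟨by nlinarith, by nlinarith⟩, Nat.mul_pos hd h3, ?_⟩, ⟨?_, dvd_mul_right _ _⟩,
      (hP m n).2 h5⟩
    · rw [mul_comm]; exact (Nat.le_div_iff_mul_le hd).1 h4
    · rw [Int.natAbs_mul]; exact dvd_mul_right _ _
  · rintro ⟨m, n⟩ - ⟨m', n'⟩ - h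
    have : (d : ℤ) ≠ 0 := by positivity
    simpa [hd.ne', this] using h
  · rintro ⟨m, n⟩ h
    simp only [mem_filter, mem_product, mem_Icc] at h
    obtain ⟨⟨⟨h1, h2⟩, h3, h4⟩, ⟨h5, h6⟩, h7⟩ := h
    obtain ⟨m, rfl⟩ := Int.natCast_dvd.2 h5
    obtain ⟨n, rfl⟩ := h6
    have hm : m.natAbs ≤ T / d := by
      rw [Nat.le_div_iff_mul_le hd]
      have : ((d : ℤ) * m).natAbs ≤ T := by lia
      rwa [Int.natAbs_mul, Int.natAbs_natCast, mul_comm] at this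
    refine ⟨(m, n), ?_, rfl⟩
    simp only [mem_filter, mem_product, mem_Icc]
    refine ⟨⟨⟨by lia, by lia⟩, Nat.pos_of_mul_pos_left h3, ?_⟩, (hP m n).1 h7⟩
    rw [Nat.le_div_iff_mul_le hd, mul_comm]; exact h4

lemma boxCount_coprime_eq_sum_moebius {p : ℕ} {P : ℤ → ℕ → Prop}
    (hP : ∀ d : ℕ, ¬ p ∣ d → ∀ m n, P (d * m) (d * n) ↔ P m n)
    (hp : ∀ m n, P m n → ¬ ((p : ℤ) ∣ m ∧ p ∣ n)) (T : ℕ) :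
    (boxCount (fun m n => m.natAbs.Coprime n ∧ P m n) T : ℤ) =
      ∑ d ∈ Icc 1 T, (if p ∣ d then 0 else ArithmeticFunction.moebius d) * boxCount P (T / d) := by
  classical
  have h1 : ∀ z ∈ Icc (-T : ℤ) T ×ˢ Icc 1 T,
      (if z.1.natAbs.Coprime z.2 ∧ P z.1 z.2 then 1 else 0 : ℤ) =
        ∑ d ∈ Icc 1 T, (if p ∣ d then 0 else ArithmeticFunction.moebius d) *
          (if (d ∣ z.1.natAbs ∧ d ∣ z.2) ∧ P z.1 z.2 then 1 else 0) := by
    rintro ⟨m, n⟩ hz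
    simp only [mem_product, mem_Icc] at hz
    obtain ⟨-, hn, hnT⟩ := hz
    by_cases h : P m n
    · have hg : m.natAbs.gcd n ≠ 0 := by
        rw [Ne, Nat.gcd_eq_zero_iff]; lia
      have hm := congrArg (fun f => f (m.natAbs.gcd n)) ArithmeticFunction.moebius_mul_coe_zeta
      simp only [ArithmeticFunction.coe_mul_zeta_apply, ArithmeticFunction.one_apply] at hm
      simp only [h, and_true, Nat.coprime_iff_gcd_eq_one]
      rw [← hm]
      refine sum_subset_zero_on_sdiff ?_ ?_ ?_
      · intro d hd
        rw [Nat.mem_divisors] at hd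
        have hdn := hd.1.trans (Nat.gcd_dvd_right _ _)
        rw [mem_Icc]
        exact ⟨Nat.pos_of_dvd_of_pos hdn hn, (Nat.le_of_dvd hn hdn).trans hnT⟩
      · intro d hd
        rw [Finset.mem_sdiff, Nat.mem_divisors, Nat.dvd_gcd_iff] at hd
        rw [if_neg (fun h => hd.2 ⟨h, hg⟩), mul_zero]
      · intro d hd
        rw [Nat.mem_divisors, Nat.dvd_gcd_iff] at hd
        rw [if_pos hd.1, if_neg, mul_one]
        exact fun hpd => hp m n h ⟨Int.natCast_dvd.2 (hpd.trans hd.1.1), hpd.trans hd.1.2⟩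
    · simp [h]
  rw [boxCount, card_filter, Nat.cast_sum]
  simp only [Nat.cast_ite, Nat.cast_one, Nat.cast_zero]
  rw [sum_congr rfl h1, sum_comm]
  refine sum_congr rfl fun d hd => ?_
  rw [← mul_sum]
  by_cases hpd : p ∣ d
  · simp [hpd]
  · rw [← boxCount_dvd_eq_boxCount_div (mem_Icc.1 hd).1 (hP d hpd), boxCount, card_filter]
    push_cast
    rfl

/-- The Dirichlet series of the Möbius function with its Euler factor at `p` removed,
evaluated at `2`. -/
noncomputable def moebiusSum (p : ℕ) : ℝ :=
  ∑' d : ℕ, ((if p ∣ d then 0 else ArithmeticFunction.moebius d : ℤ) : ℝ) * (1 / (d : ℝ) ^ 2)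

lemma abs_moebius_ite_le_one (p d : ℕ) :
    |((if p ∣ d then 0 else ArithmeticFunction.moebius d : ℤ) : ℝ)| ≤ 1 := by
  split_ifs
  · simp
  · exact_mod_cast ArithmeticFunction.abs_moebius_le_one

lemma moebiusSum_ne_zero {p : ℕ} (hp : 1 < p) : moebiusSum p ≠ 0 := by
  set f : ℕ → ℝ := fun d =>
    ((if p ∣ d then 0 else ArithmeticFunction.moebius d : ℤ) : ℝ) * (1 / (d : ℝ) ^ 2) with hf
  have hz := hasSum_zeta_two
  have hb : ∀ d, |f d| ≤ 1 / (d : ℝ) ^ 2 := fun d => by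
    rw [hf, abs_mul, abs_of_nonneg (by positivity : (0 : ℝ) ≤ 1 / (d : ℝ) ^ 2)]
    exact mul_le_of_le_one_left (by positivity) (abs_moebius_ite_le_one p d)
  have hs : Summable f := Summable.of_norm_bounded hz.summable hb
  have h1 : f 1 = 1 := by simp [hf, hp.ne']
  have hsum : HasSum (fun d : ℕ => f d + 1 / (d : ℝ) ^ 2) (moebiusSum p + Real.pi ^ 2 / 6) :=
    hs.hasSum.add hz
  have hle := sum_le_hasSum {1} (fun d _ => by linarith [neg_abs_le (f d), hb d]) hsum
  simp only [sum_singleton, h1] at hle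
  have hpi := Real.pi_lt_d2
  have hpi0 := Real.pi_pos
  norm_num at hle
  intro h0
  nlinarith

lemma tendsto_boxCount_coprime_div_sq {p : ℕ} {P : ℤ → ℕ → Prop}
    (hP : ∀ d : ℕ, ¬ p ∣ d → ∀ m n, P (d * m) (d * n) ↔ P m n)
    (hp : ∀ m n, P m n → ¬ ((p : ℤ) ∣ m ∧ p ∣ n)) {c : ℝ}
    (hc : Tendsto (fun T : ℕ => (boxCount P T : ℝ) / (T : ℝ) ^ 2) atTop (𝓝 c)) :
    Tendsto (fun T : ℕ =>
      (boxCount (fun m n => m.natAbs.Coprime n ∧ P m n) T : ℝ) / (T : ℝ) ^ 2) atTop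
      (𝓝 (moebiusSum p * c)) := by
  set w : ℕ → ℝ := fun d => ((if p ∣ d then 0 else ArithmeticFunction.moebius d : ℤ) : ℝ) with hw
  have hzero : boxCount P 0 = 0 := by simp [boxCount]
  have heq : ∀ T : ℕ, (boxCount (fun m n => m.natAbs.Coprime n ∧ P m n) T : ℝ) / (T : ℝ) ^ 2 =
      ∑' d : ℕ, w d * ((boxCount P (T / d) : ℝ) / (T : ℝ) ^ 2) := by
    intro T
    rw [tsum_eq_sum (s := Icc 1 T)]
    · have := congrArg (Int.cast (R := ℝ)) (boxCount_coprime_eq_sum_moebius hP hp T)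
      rw [Int.cast_natCast] at this
      rw [this, Int.cast_sum, sum_div]
      refine sum_congr rfl fun d _ => ?_
      rw [Int.cast_mul, Int.cast_natCast, mul_div_assoc]
    · intro d hd
      have : T / d = 0 := by
        rw [mem_Icc] at hd
        rw [Nat.div_eq_zero_iff]; lia
      simp [this, hzero]
  simp only [heq]
  rw [moebiusSum, ← tsum_mul_right]
  refine tendsto_tsum_of_dominated_convergence (bound := fun d : ℕ => 3 * (1 / (d : ℝ) ^ 2))
    (hasSum_zeta_two.summable.mul_left 3) ?_ ?_
  · intro d
    rw [mul_assoc]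
    refine Tendsto.const_mul _ ?_
    rcases Nat.eq_zero_or_pos d with rfl | hd
    · simp [hzero]
    have hd' : (0 : ℝ) < d := mod_cast hd
    have hdiv : Tendsto (fun T : ℕ => T / d) atTop atTop := Nat.tendsto_div_const_atTop hd.ne'
    have h1 := hc.comp hdiv
    have h2 : Tendsto (fun T : ℕ => ((T / d : ℕ) : ℝ) / (T : ℝ)) atTop (𝓝 (1 / d)) := by
      have := (tendsto_nat_floor_mul_div_atTop (R := ℝ) (a := 1 / d) (by positivity)).comp
        tendsto_natCast_atTop_atTop
      refine this.congr fun T => ?_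
      rw [Function.comp, one_div_mul_eq_div, Nat.floor_div_eq_div]
    have h3 := h1.mul (h2.pow 2)
    rw [mul_comm, one_div, ← inv_pow, ← one_div]
    refine h3.congr' ?_
    filter_upwards [hdiv.eventually_gt_atTop 0] with T hT
    have : ((T / d : ℕ) : ℝ) ≠ 0 := by exact_mod_cast hT.ne'
    simp only [Function.comp]
    field_simp
  · refine Eventually.of_forall fun T d => ?_
    rw [norm_mul, Real.norm_eq_abs, Real.norm_eq_abs]
    refine (mul_le_of_le_one_left (abs_nonneg _) (abs_moebius_ite_le_one p d)).trans ?_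
    rw [abs_of_nonneg (by positivity)]
    rcases Nat.eq_zero_or_pos T with rfl | hT
    · simp
    rw [div_le_iff₀ (by positivity)]
    refine (boxCount_le P _).trans ?_
    have : ((T / d : ℕ) : ℝ) ≤ T / d := Nat.cast_div_le
    calc 3 * ((T / d : ℕ) : ℝ) ^ 2 ≤ 3 * ((T : ℝ) / d) ^ 2 := by gcongr
      _ = _ := by ring

lemma boxCount_true (T : ℕ) : boxCount (fun _ _ => True) T = (2 * T + 1) * T := by
  rw [boxCount, filter_true, card_product, Int.card_Icc, Nat.card_Icc]
  congr 1
  lia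

lemma tendsto_boxCount_not_dvd_and_dvd_div_sq {p : ℕ} (hp : 0 < p) :
    Tendsto (fun T : ℕ => (boxCount (fun m n => ¬ ((p : ℤ) ∣ m ∧ p ∣ n)) T : ℝ) / (T : ℝ) ^ 2)
      atTop (𝓝 (2 - 2 / (p : ℝ) ^ 2)) := by
  classical
  have hsplit : ∀ T : ℕ, (boxCount (fun m n => ¬ ((p : ℤ) ∣ m ∧ p ∣ n)) T : ℝ) =
      (2 * T + 1) * T - (2 * (T / p : ℕ) + 1) * (T / p : ℕ) := by
    intro T
    have h1 := boxCount_dvd_eq_boxCount_div (P := fun _ _ => True) hp (by simp) T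
    have h2 : boxCount (fun m n => (p : ℤ) ∣ m ∧ p ∣ n) T +
        boxCount (fun m n => ¬ ((p : ℤ) ∣ m ∧ p ∣ n)) T = boxCount (fun _ _ => True) T := by
      simp only [boxCount, filter_true]
      exact card_filter_add_card_filter_not _
    simp only [and_true, ← Int.natCast_dvd] at h1
    rw [h1, boxCount_true, boxCount_true] at h2
    rw [eq_sub_iff_add_eq']
    exact_mod_cast h2
  have hdiv : Tendsto (fun T : ℕ => ((T / p : ℕ) : ℝ) / (T : ℝ)) atTop (𝓝 (1 / p)) := by
    have := (tendsto_nat_floor_mul_div_atTop (R := ℝ) (a := 1 / p) (by positivity)).comp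
      tendsto_natCast_atTop_atTop
    refine this.congr fun T => ?_
    rw [Function.comp, one_div_mul_eq_div, Nat.floor_div_eq_div]
  have hinv : Tendsto (fun T : ℕ => 1 / (T : ℝ)) atTop (𝓝 0) := tendsto_one_div_atTop_nhds_zero_nat
  have hlim := (hinv.const_add 2).sub (((hdiv.const_mul 2).add hinv).mul hdiv)
  convert hlim.congr' _ using 2
  · ring
  · filter_upwards [eventually_gt_atTop 0] with T hT
    have : (T : ℝ) ≠ 0 := by exact_mod_cast hT.ne'
    rw [hsplit]
    field_simp

lemma abs_card_Ioc_filter_dvd_sub_sub_le {a b : ℤ} (hab : a ≤ b) {r : ℤ} (hr : 0 < r) (v : ℤ) :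
    |(#{x ∈ Ioc a b | r ∣ x - v} : ℝ) - ((b - a : ℤ) : ℝ) / r| ≤ 1 := by
  have h := Int.Ioc_filter_modEq_card a b hr v
  have hset : #{x ∈ Ioc a b | x ≡ v [ZMOD r]} = #{x ∈ Ioc a b | r ∣ x - v} := by
    congr 1
    ext x
    simp only [mem_filter, Int.modEq_iff_dvd, dvd_sub_comm (b := v)]
  have hr' : (0 : ℚ) < r := mod_cast hr
  have hab' : (a : ℚ) ≤ b := mod_cast hab
  rw [hset, max_eq_left] at h
  · have h' : |(#{x ∈ Ioc a b | r ∣ x - v} : ℚ) - ((b - a : ℤ) : ℚ) / r| ≤ 1 := by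
      have h2 := congrArg (Int.cast (R := ℚ)) h
      rw [Int.cast_natCast, Int.cast_sub] at h2
      rw [h2]
      have h3 := Int.floor_le ((b - v : ℚ) / r)
      have h4 := Int.lt_floor_add_one ((b - v : ℚ) / r)
      have h5 := Int.floor_le ((a - v : ℚ) / r)
      have h6 := Int.lt_floor_add_one ((a - v : ℚ) / r)
      have h7 : ((b - a : ℤ) : ℚ) / r = (b - v : ℚ) / r - (a - v : ℚ) / r := by
        push_cast; ring
      rw [h7, abs_le]
      constructor <;> linarith
    exact_mod_cast h'
  · rw [sub_nonneg]
    gcongr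

lemma card_Icc_one_filter_intCast (Q : ℤ → Prop) [DecidablePred Q] (T : ℕ) :
    #{n ∈ Icc 1 T | Q (n : ℕ)} = #{x ∈ Ioc (0 : ℤ) T | Q x} := by
  rw [← card_map (Nat.castEmbedding (R := ℤ))]
  congr 1
  ext x
  simp only [Finset.mem_map, mem_filter, mem_Icc, mem_Ioc, Nat.castEmbedding_apply]
  constructor
  · rintro ⟨n, ⟨⟨h1, h2⟩, h3⟩, rfl⟩
    exact ⟨by lia, h3⟩
  · rintro ⟨⟨h1, h2⟩, h3⟩
    lift x to ℕ using h1.le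
    exact ⟨x, ⟨by lia, h3⟩, rfl⟩

lemma abs_card_filter_dvd_sub_and_not_dvd_sub_sub_le {q q' : ℤ} (hq : 0 < q) (hq' : 0 < q')
    (h : q ∣ q') (v : ℤ) (T : ℕ) :
    |(#{n ∈ Icc 1 T | q ∣ (n : ℕ) - v ∧ ¬ q' ∣ (n : ℕ) - v} : ℝ) -
      (1 / (q : ℝ) - 1 / q') * T| ≤ 2 := by
  have hc := card_Icc_one_filter_intCast (fun x => q ∣ x - v ∧ ¬ q' ∣ x - v) T
  rw [hc]
  have hsplit : #{x ∈ Ioc (0 : ℤ) T | q' ∣ x - v} +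
      #{x ∈ Ioc (0 : ℤ) T | q ∣ x - v ∧ ¬ q' ∣ x - v} = #{x ∈ Ioc (0 : ℤ) T | q ∣ x - v} := by
    rw [← card_filter_add_card_filter_not (s := {x ∈ Ioc (0 : ℤ) T | q ∣ x - v})
      (fun x => q' ∣ x - v), filter_filter, filter_filter]
    congr 2
    ext x
    simp only [mem_filter]
    exact and_congr_right fun _ => ⟨fun hx => ⟨h.trans hx, hx⟩, fun hx => hx.2⟩
  have h1 := abs_card_Ioc_filter_dvd_sub_sub_le (Int.natCast_nonneg T) hq v
  have h2 := abs_card_Ioc_filter_dvd_sub_sub_le (Int.natCast_nonneg T) hq' v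
  have hs := congrArg (Nat.cast (R := ℝ)) hsplit
  rw [Nat.cast_add] at hs
  rw [← eq_sub_iff_add_eq'] at hs
  rw [hs]
  rw [abs_le] at h1 h2 ⊢
  have e1 : (((T : ℤ) - 0 : ℤ) : ℝ) / q = 1 / q * T := by push_cast; ring
  have e2 : (((T : ℤ) - 0 : ℤ) : ℝ) / q' = 1 / q' * T := by push_cast; ring
  rw [e1] at h1
  rw [e2] at h2
  constructor <;> linarith

lemma tendsto_card_filter_not_dvd_div {p : ℕ} (hp : 0 < p) :
    Tendsto (fun T : ℕ => (#{m ∈ Icc (-T : ℤ) T | ¬ (p : ℤ) ∣ m} : ℝ) / T) atTop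
      (𝓝 (2 - 2 / p)) := by
  have hbound : ∀ T : ℕ, |(#{m ∈ Icc (-T : ℤ) T | ¬ (p : ℤ) ∣ m} : ℝ) -
      (2 - 2 / p) * T| ≤ 3 := by
    intro T
    have h1 := abs_card_Ioc_filter_dvd_sub_sub_le (a := -T - 1) (b := T) (r := p)
      (by lia) (mod_cast hp) 0
    have hI : Ioc (-T - 1 : ℤ) T = Icc (-T : ℤ) T := by
      ext x; simp only [mem_Ioc, mem_Icc]; lia
    have hs := card_filter_add_card_filter_not (s := Icc (-T : ℤ) T) (fun m => (p : ℤ) ∣ m)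
    rw [Int.card_Icc, show ((T : ℤ) + 1 - -T).toNat = 2 * T + 1 by lia] at hs
    have hs' := congrArg (Nat.cast (R := ℝ)) hs
    push_cast at hs'
    rw [← eq_sub_iff_add_eq'] at hs'
    simp only [sub_zero, hI] at h1
    rw [hs']
    have hp1 : (1 : ℝ) ≤ p := mod_cast hp
    have e1 : ((T - (-T - 1) : ℤ) : ℝ) / (p : ℤ) = 2 / p * T + 1 / p := by push_cast; ring
    have e2 : 1 / (p : ℝ) ≤ 1 := by rw [div_le_one (by positivity)]; exact hp1
    have e3 : 0 ≤ 1 / (p : ℝ) := by positivity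
    rw [e1] at h1
    rw [abs_le] at h1 ⊢
    constructor <;> linarith
  have h0 : Tendsto (fun T : ℕ => ((#{m ∈ Icc (-T : ℤ) T | ¬ (p : ℤ) ∣ m} : ℝ) -
      (2 - 2 / p) * T) / T) atTop (𝓝 0) := by
    refine squeeze_zero_norm (fun T => ?_) (tendsto_const_div_atTop_nhds_zero_nat 3)
    rw [norm_div, Real.norm_eq_abs, Real.norm_natCast]
    gcongr
    exact hbound T
  have h1 := h0.add_const (2 - 2 / (p : ℝ))
  rw [zero_add] at h1
  refine h1.congr' ?_
  filter_upwards [eventually_gt_atTop 0] with T hT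
  have : (T : ℝ) ≠ 0 := by exact_mod_cast hT.ne'
  field_simp
  ring

lemma tendsto_boxCount_dvd_sub_mul_div_sq {p : ℕ} (hp : 0 < p) {q q' : ℤ} (hq : 0 < q)
    (hq' : 0 < q') (h : q ∣ q') (a : ℤ) :
    Tendsto (fun T : ℕ => (boxCount (fun m n => ¬ (p : ℤ) ∣ m ∧ q ∣ n - a * m ∧
      ¬ q' ∣ n - a * m) T : ℝ) / (T : ℝ) ^ 2) atTop
      (𝓝 ((1 / (q : ℝ) - 1 / q') * (2 - 2 / p))) := by
  classical
  set M : ℕ → ℝ := fun T => #{m ∈ Icc (-T : ℤ) T | ¬ (p : ℤ) ∣ m} with hM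
  have hlim := tendsto_card_filter_not_dvd_div hp
  have hbound : ∀ T : ℕ, |(boxCount (fun m n => ¬ (p : ℤ) ∣ m ∧ q ∣ n - a * m ∧
      ¬ q' ∣ n - a * m) T : ℝ) - M T * ((1 / (q : ℝ) - 1 / q') * T)| ≤ M T * 2 := by
    intro T
    have hsum : boxCount (fun m n => ¬ (p : ℤ) ∣ m ∧ q ∣ n - a * m ∧ ¬ q' ∣ n - a * m) T =
        ∑ m ∈ Icc (-T : ℤ) T with ¬ (p : ℤ) ∣ m,
          #{n ∈ Icc 1 T | q ∣ (n : ℕ) - a * m ∧ ¬ q' ∣ (n : ℕ) - a * m} := by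
      rw [boxCount, card_filter, sum_product, sum_filter]
      refine sum_congr rfl fun m _ => ?_
      by_cases hm : (p : ℤ) ∣ m
      · simp [hm]
      · simp only [hm, not_false_eq_true, true_and, if_true, card_filter]
    have hcard : ∀ x : ℝ, M T * x = ∑ m ∈ Icc (-T : ℤ) T with ¬ (p : ℤ) ∣ m, x := by
      intro x; rw [sum_const, nsmul_eq_mul]
    rw [hsum, Nat.cast_sum, hcard, hcard, ← sum_sub_distrib]
    refine (abs_sum_le_sum_abs _ _).trans (sum_le_sum fun m _ => ?_)
    exact abs_card_filter_dvd_sub_and_not_dvd_sub_sub_le hq hq' h (a * m) T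
  have h0 : Tendsto (fun T : ℕ => ((boxCount (fun m n => ¬ (p : ℤ) ∣ m ∧ q ∣ n - a * m ∧
      ¬ q' ∣ n - a * m) T : ℝ) - M T * ((1 / (q : ℝ) - 1 / q') * T)) / (T : ℝ) ^ 2)
      atTop (𝓝 0) := by
    have hz := hlim.mul (tendsto_const_div_atTop_nhds_zero_nat (2 : ℝ))
    rw [mul_zero] at hz
    refine squeeze_zero_norm (fun T => ?_) hz
    rw [norm_div, Real.norm_eq_abs, norm_pow, Real.norm_natCast, div_mul_div_comm, ← sq]
    gcongr
    exact hbound T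
  have h1 := h0.add (hlim.const_mul (1 / (q : ℝ) - 1 / q'))
  rw [zero_add] at h1
  refine h1.congr' ?_
  filter_upwards [eventually_gt_atTop 0] with T hT
  have : (T : ℝ) ≠ 0 := by exact_mod_cast hT.ne'
  rw [← mul_div_assoc, sub_div, sub_add_eq_add_sub, add_sub_assoc, add_eq_left, sub_eq_zero,
    div_eq_div_iff this (by positivity)]
  ring

end BoxCounts

/-- For a prime `p`, a nonzero `x ∈ ℚ_p` and `e ∈ ℤ` with `v_p(x) < e < -1`,
the proportion of rationals `r` of height at most `T` with `v_p(r - x) = e`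
(equivalently `|r - x|_p = p^{-e}`) tends to `p^{2 v_p(x) - e} (p-1)/(p+1)`. -/
theorem sphere_height_measure_of_val_lt_lt_neg_one
    (p : ℕ) [hp : Fact p.Prime] (x : ℚ_[p]) (hx : x ≠ 0) (e : ℤ)
    (hve : x.valuation < e) (he : e < -1) :
    Filter.Tendsto
      (fun T : ℕ =>
        (Nat.card {r : ℚ // ratHeight r ≤ T ∧ ‖(r : ℚ_[p]) - x‖ = (p : ℝ) ^ (-e)} : ℝ) /
        (Nat.card {r : ℚ // ratHeight r ≤ T} : ℝ))
      Filter.atTop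
      (nhds ((p : ℝ) ^ (2 * x.valuation - e) * ((p : ℝ) - 1) / ((p : ℝ) + 1))) := by
  have hp2 : 1 < p := hp.out.one_lt
  have hp1 : (1 : ℝ) < p := mod_cast hp2
  have hv : x.valuation < 0 := by lia
  obtain ⟨s, hs⟩ := Int.eq_ofNat_of_zero_le (a := e - 2 * x.valuation) (by lia)
  have hy : ‖x⁻¹‖ ≤ 1 := by
    rw [norm_inv, Padic.norm_eq_zpow_neg_valuation hx, ← zpow_neg, neg_neg]
    exact (zpow_lt_one_of_neg₀ hp1 hv).le
  obtain ⟨a, ha⟩ := Padic.exists_int_norm_sub_le hy (s + 1)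
  set P : ℤ → ℕ → Prop := fun m n => ¬ (p : ℤ) ∣ m ∧ (p : ℤ) ^ s ∣ n - a * m ∧
    ¬ (p : ℤ) ^ (s + 1) ∣ n - a * m with hPdef
  set P₀ : ℤ → ℕ → Prop := fun m n => ¬ ((p : ℤ) ∣ m ∧ p ∣ n) with hP₀def
  have hnum : ∀ T : ℕ,
      Nat.card {r : ℚ // ratHeight r ≤ T ∧ ‖(r : ℚ_[p]) - x‖ = (p : ℝ) ^ (-e)} =
        boxCount (fun m n => m.natAbs.Coprime n ∧ P m n) T := by
    intro T
    simp only [Padic.norm_sub_eq_iff_num_den hx hve hv hs.symm ha]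
    exact natCard_ratHeight_le_eq_boxCount P T
  have hden : ∀ T : ℕ, Nat.card {r : ℚ // ratHeight r ≤ T} =
      boxCount (fun m n => m.natAbs.Coprime n ∧ P₀ m n) T := by
    intro T
    rw [← natCard_ratHeight_le_eq_boxCount]
    refine Nat.card_congr (Equiv.subtypeEquivRight fun r => (and_iff_left ?_).symm)
    rintro ⟨h1, h2⟩
    have h := Nat.dvd_gcd (Int.natCast_dvd.1 h1) h2
    rw [r.reduced] at h
    exact hp2.ne' (Nat.dvd_one.1 h)
  have hdvd : ∀ d : ℕ, ¬ p ∣ d → ∀ (k : ℕ) (z : ℤ), (p : ℤ) ^ k ∣ d * z ↔ (p : ℤ) ^ k ∣ z := by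
    intro d hd k z
    have : IsCoprime ((p : ℤ) ^ k) d :=
      (Nat.isCoprime_iff_coprime.2 ((Nat.Prime.coprime_iff_not_dvd hp.out).2 hd)).pow_left
    exact ⟨this.dvd_of_dvd_mul_left, fun h => h.mul_left _⟩
  have hP : ∀ d : ℕ, ¬ p ∣ d → ∀ m n, P (d * m) (d * n) ↔ P m n := by
    intro d hd m n
    have h1 := hdvd d hd 1 m
    rw [pow_one] at h1
    simp only [hPdef, h1]
    rw [show (((d * n : ℕ) : ℤ) - a * (d * m)) = d * (n - a * m) by push_cast; ring,
      hdvd d hd, hdvd d hd]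
  have hP₀ : ∀ d : ℕ, ¬ p ∣ d → ∀ m n, P₀ (d * m) (d * n) ↔ P₀ m n := by
    intro d hd m n
    have h1 := hdvd d hd 1 m
    rw [pow_one] at h1
    simp only [hP₀def, h1, hp.out.dvd_mul, hd, false_or]
  have hpow : ∀ k : ℕ, (0 : ℤ) < (p : ℤ) ^ k := fun k => by have := hp.out.pos; positivity
  have hlim := tendsto_boxCount_coprime_div_sq hP (fun m n h h' => h.1 h'.1)
    (tendsto_boxCount_dvd_sub_mul_div_sq hp.out.pos (hpow s) (hpow (s + 1))
      (pow_dvd_pow _ s.le_succ) a)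
  have hlim₀ := tendsto_boxCount_coprime_div_sq hP₀ (fun m n h => h)
    (tendsto_boxCount_not_dvd_and_dvd_div_sq hp.out.pos)
  have hK := moebiusSum_ne_zero hp2
  have hpp : (p : ℝ) ≠ 0 := by positivity
  have hc : (2 - 2 / (p : ℝ) ^ 2) ≠ 0 := by
    have : 2 / (p : ℝ) ^ 2 < 2 := by
      rw [div_lt_iff₀ (by positivity)]
      nlinarith
    linarith
  simp only [hnum, hden]
  convert (hlim.div hlim₀ (mul_ne_zero hK hc)).congr' _ using 2
  · rw [mul_div_mul_left _ _ hK, show 2 * x.valuation - e = -(s : ℤ) by lia, zpow_neg,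
      zpow_natCast]
    have h1 : (p : ℝ) - 1 ≠ 0 := by linarith
    have h2 : (p : ℝ) + 1 ≠ 0 := by linarith
    push_cast
    rw [eq_div_iff hc]
    field_simp
    ring
  · filter_upwards [Filter.eventually_gt_atTop 0] with T hT
    have : (T : ℝ) ^ 2 ≠ 0 := by positivity
    simp only [Pi.div_apply]
    exact div_div_div_cancel_right₀ this _ _
end

section
/- Let p be a prime and let t > 1, a, e be integers with p ∤ t, and let T > 0 be a real number. Then the number of integers n with 0 ≤ n ≤ T, gcd(n, t) = 1, and v_p(n − a·t) ≥ e equals p^{-max(0,e)} · (T/t) · φ(t) up to an error of absolute value at most 2·d(t), i.e. |#{n ∈ ℤ : 0 ≤ n ≤ T, gcd(n,t) = 1, v_p(n − a t) ≥ e} − p^{-max(0,e)} (T/t) φ(t)| ≤ 2 d(t). -/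
open ArithmeticFunction ArithmeticFunction.Moebius

theorem sum_divisors_moebius (n : ℕ) :
    ∑ d ∈ n.divisors, (μ d : ℝ) = if n = 1 then 1 else 0 := by
  have h := congrArg (fun f : ArithmeticFunction ℤ => f n) moebius_mul_coe_zeta
  simp only [coe_mul_zeta_apply, one_apply] at h
  exact_mod_cast h

theorem sum_divisors_moebius_div (n : ℕ) (hn : 0 < n) :
    ∑ d ∈ n.divisors, (μ d : ℝ) / d = n.totient / n := by
  have h := (sum_eq_iff_sum_mul_moebius_eq (R := ℝ) (f := fun k => (k.totient : ℝ))
    (g := fun k => (k : ℝ))).1 (fun k _ => by exact_mod_cast Nat.sum_totient k) n hn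
  rw [Nat.sum_divisorsAntidiagonal (fun i j => (μ i : ℝ) * (j : ℝ))] at h
  have hn' : (n : ℝ) ≠ 0 := by positivity
  rw [← h, Finset.sum_div]
  refine Finset.sum_congr rfl fun d hd => ?_
  have hd0 : (d : ℝ) ≠ 0 := by
    exact_mod_cast (Nat.pos_of_mem_divisors hd).ne'
  rw [Nat.cast_div (Nat.dvd_of_mem_divisors hd) hd0]
  field_simp

/-- The indicator of coprimality with `t` as a Möbius sum over the divisors of `t`. -/
theorem sum_divisors_moebius_of_dvd (t n : ℤ) (ht : t ≠ 0) :
    ∑ d ∈ t.natAbs.divisors, (if (d : ℤ) ∣ n then (μ d : ℝ) else 0)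
      = if Int.gcd n t = 1 then 1 else 0 := by
  rw [← sum_divisors_moebius, ← Finset.sum_filter]
  refine Finset.sum_congr ?_ fun _ _ => rfl
  ext d
  simp only [Finset.mem_filter, Nat.mem_divisors, Int.gcd, Nat.dvd_gcd_iff, Int.natCast_dvd]
  have h1 : t.natAbs ≠ 0 := by simpa using ht
  have h2 : n.natAbs.gcd t.natAbs ≠ 0 := Nat.gcd_ne_zero_right h1
  tauto

/-- A residue class modulo `m` has `T / m` elements in `[0, T]`, up to an error of at most `1`. -/
theorem abs_card_filter_dvd_sub_div_le (m : ℕ) (hm : 0 < m) (r : ℤ) (T : ℝ) (hT : 0 ≤ T) :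
    |(((Finset.Icc 0 ⌊T⌋).filter fun n : ℤ => (m : ℤ) ∣ n - r).card : ℝ) - T / m| ≤ 1 := by
  have hm' : (0 : ℝ) < m := by exact_mod_cast hm
  have key : ((Finset.Icc 0 ⌊T⌋).filter fun n : ℤ => (m : ℤ) ∣ n - r)
      = (Finset.Icc ⌈-(r : ℝ) / m⌉ ⌊(T - r) / m⌋).image fun k => r + m * k := by
    ext n
    simp only [Finset.mem_filter, Finset.mem_image, Finset.mem_Icc, Int.le_floor, Int.ceil_le,
      div_le_iff₀ hm', le_div_iff₀ hm']
    constructor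
    · rintro ⟨⟨h0, h1⟩, k, hk⟩
      have hn : n = r + m * k := by linarith
      have h0' : (0 : ℝ) ≤ n := by exact_mod_cast h0
      have hn' : (n : ℝ) = r + m * k := by exact_mod_cast hn
      exact ⟨k, ⟨by linarith, by linarith⟩, hn.symm⟩
    · rintro ⟨k, ⟨h0, h1⟩, rfl⟩
      refine ⟨⟨?_, by push_cast; linarith⟩, by simp⟩
      have : (0 : ℝ) ≤ ((r + m * k : ℤ) : ℝ) := by push_cast; linarith
      exact_mod_cast this
  have hinj : Function.Injective fun k : ℤ => r + m * k := fun a b hab => by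
    simpa [hm.ne'] using hab
  rw [key, Finset.card_image_of_injective _ hinj, Int.card_Icc]
  have hf1 := Int.floor_le ((T - r) / m)
  have hf2 := Int.lt_floor_add_one ((T - r) / m)
  have hc1 := Int.le_ceil (-(r : ℝ) / m)
  have hc2 := Int.ceil_lt_add_one (-(r : ℝ) / m)
  have hsub : (T - r) / m - -(r : ℝ) / m = T / m := by ring
  have hT' : 0 ≤ T / m := by positivity
  have hnonneg : 0 ≤ ⌊(T - r) / m⌋ + 1 - ⌈-(r : ℝ) / m⌉ := by
    have : (-1 : ℝ) < ((⌊(T - r) / m⌋ + 1 - ⌈-(r : ℝ) / m⌉ : ℤ) : ℝ) := by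
      push_cast; linarith
    have : -1 < ⌊(T - r) / m⌋ + 1 - ⌈-(r : ℝ) / m⌉ := by exact_mod_cast this
    omega
  have hcast : (((⌊(T - r) / m⌋ + 1 - ⌈-(r : ℝ) / m⌉).toNat : ℕ) : ℝ)
      = ⌊(T - r) / m⌋ + 1 - ⌈-(r : ℝ) / m⌉ := by
    have := Int.toNat_of_nonneg hnonneg
    exact_mod_cast congrArg (Int.cast : ℤ → ℝ) this
  rw [hcast, abs_le]
  constructor <;> linarith

/-- Integers of `[0, T]` coprime to `t` and congruent to `a * t` modulo `q`, for `q` coprime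
to `t`. -/
theorem abs_card_coprime_filter_sub_le (q : ℕ) (hq : 0 < q) (t a : ℤ) (ht : 0 < t)
    (hqt : IsCoprime (q : ℤ) t) (T : ℝ) (hT : 0 ≤ T) :
    |(((Finset.Icc 0 ⌊T⌋).filter fun n : ℤ =>
        Int.gcd n t = 1 ∧ (q : ℤ) ∣ n - a * t).card : ℝ)
      - (q : ℝ)⁻¹ * (T / t) * t.natAbs.totient| ≤ t.natAbs.divisors.card := by
  have hcard : (((Finset.Icc 0 ⌊T⌋).filter fun n : ℤ =>
        Int.gcd n t = 1 ∧ (q : ℤ) ∣ n - a * t).card : ℝ)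
      = ∑ d ∈ t.natAbs.divisors, (μ d : ℝ) *
        ((Finset.Icc 0 ⌊T⌋).filter fun n : ℤ => ((d * q : ℕ) : ℤ) ∣ n - a * t).card := by
    simp only [Finset.card_filter, Nat.cast_sum, Finset.mul_sum]
    rw [Finset.sum_comm]
    refine Finset.sum_congr rfl fun n _ => ?_
    by_cases hn : (q : ℤ) ∣ n - a * t
    · simp only [hn, and_true, Nat.cast_ite, Nat.cast_one, Nat.cast_zero,
        ← sum_divisors_moebius_of_dvd t n ht.ne']
      refine Finset.sum_congr rfl fun d hd => ?_
      have hdt : (d : ℤ) ∣ t := Int.natCast_dvd.2 (Nat.dvd_of_mem_divisors hd)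
      have hiff : (d : ℤ) ∣ n ↔ ((d * q : ℕ) : ℤ) ∣ n - a * t := by
        rw [← dvd_sub_left (hdt.mul_left a), Nat.cast_mul]
        exact ⟨fun h => (hqt.of_isCoprime_of_dvd_right hdt).symm.mul_dvd h hn,
          fun h => dvd_of_mul_right_dvd h⟩
      simp [hiff]
    · have hd (d : ℕ) : ¬ (d : ℤ) * q ∣ n - a * t := fun h =>
        hn (dvd_of_mul_left_dvd h)
      simp [hn, hd]
  have ht' : ((t.natAbs : ℕ) : ℝ) = t := by
    rw [Nat.cast_natAbs, abs_of_pos ht]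
  have hmain : (q : ℝ)⁻¹ * (T / t) * t.natAbs.totient
      = ∑ d ∈ t.natAbs.divisors, (μ d : ℝ) * (T / (d * q : ℕ)) := by
    have h := sum_divisors_moebius_div t.natAbs (Int.natAbs_pos.2 ht.ne')
    rw [ht'] at h
    calc (q : ℝ)⁻¹ * (T / t) * t.natAbs.totient
        = (q : ℝ)⁻¹ * T * (t.natAbs.totient / t) := by ring
      _ = _ := by
        rw [← h, Finset.mul_sum]
        refine Finset.sum_congr rfl fun d _ => ?_
        push_cast
        rw [div_eq_mul_inv, div_eq_mul_inv, mul_inv]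
        ring
  rw [hcard, hmain, ← Finset.sum_sub_distrib, Finset.card_eq_sum_ones, Nat.cast_sum]
  refine (Finset.abs_sum_le_sum_abs _ _).trans (Finset.sum_le_sum fun d hd => ?_)
  rw [← mul_sub, abs_mul, Nat.cast_one]
  have hμ : |(μ d : ℝ)| ≤ 1 := by exact_mod_cast abs_moebius_le_one (n := d)
  exact mul_le_one₀ hμ (abs_nonneg _) (abs_card_filter_dvd_sub_div_le _
    (Nat.mul_pos (Nat.pos_of_mem_divisors hd) hq) _ _ hT)


/-- Lemma 1 of the paper, case `p ∤ t`: for a prime `p`, integers `t > 1`, `a`,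
`e` with `p ∤ t`, and a real `T > 0`, the number of integers `0 ≤ n ≤ T` with
`gcd(n,t) = 1` and `v_p(n - a t) ≥ e` (expressed as `p^{max(e,0)} ∣ n - a t`,
which is the correct reading with `v_p(0) = +∞`) is
`p^{-max(0,e)} (T/t) φ(t)` up to an error of at most `2 d(t)`. -/
theorem count_coprime_padic_cond_not_dvd
    (p : ℕ) (hp : p.Prime) (t a e : ℤ) (ht : 1 < t) (hpt : ¬ (p : ℤ) ∣ t)
    (T : ℝ) (hT : 0 < T) :
    |(Nat.card {n : ℤ // 0 ≤ n ∧ (n : ℝ) ≤ T ∧ Int.gcd n t = 1 ∧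
        (p : ℤ) ^ e.toNat ∣ (n - a * t)} : ℝ)
      - (p : ℝ) ^ (-(max 0 e)) * (T / (t : ℝ)) * (t.natAbs.totient : ℝ)|
      ≤ 2 * (t.natAbs.divisors.card : ℝ) := by
  have hcop : IsCoprime ((p ^ e.toNat : ℕ) : ℤ) t := by
    rw [Nat.cast_pow]
    exact ((Nat.prime_iff_prime_int.1 hp).coprime_iff_not_dvd.2 hpt).pow_left
  have hpow : (p : ℝ) ^ (-(max 0 e)) = ((p ^ e.toNat : ℕ) : ℝ)⁻¹ := by
    rw [zpow_neg, max_comm, ← Int.ofNat_toNat, zpow_natCast, Nat.cast_pow]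
  have hcard : Nat.card {n : ℤ // 0 ≤ n ∧ (n : ℝ) ≤ T ∧ Int.gcd n t = 1 ∧
        (p : ℤ) ^ e.toNat ∣ (n - a * t)}
      = ((Finset.Icc 0 ⌊T⌋).filter fun n : ℤ =>
        Int.gcd n t = 1 ∧ ((p ^ e.toNat : ℕ) : ℤ) ∣ n - a * t).card := by
    rw [Nat.subtype_card]
    intro n
    simp [Int.le_floor, and_assoc]
  rw [hcard, hpow]
  have h := abs_card_coprime_filter_sub_le _ (pow_pos hp.pos e.toNat) t a (by omega) hcop T hT.le
  have h0 : (0 : ℝ) ≤ t.natAbs.divisors.card := Nat.cast_nonneg _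
  linarith
end

section
/- Let p be a prime, x ∈ ℚ_p, and e a positive integer with v_p(x) ≥ e (this includes x = 0). For any positive integer t, the number N(t) = #{r ∈ ℚ : H(r) = t and v_p(r − x) ≥ e} satisfies: if v_p(t) = 0 then |N(t) − 2 p^{-e} φ(t)| ≤ 4 d(t); if 0 < v_p(t) < e then N(t) = 0; and if v_p(t) ≥ e then N(t) = 2 φ(t). -/
/-- If `x` lies in the ball of radius `p ^ (-E)` around `0`, then a rational is within `p ^ (-E)` of
`x` if and only if its numerator is divisible by `p ^ E`. -/
theorem norm_ratCast_sub_le_iff_dvd_num (p : ℕ) [Fact p.Prime] (x : ℚ_[p]) {E : ℕ} (hE : 0 < E)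
    (hx : ‖x‖ ≤ (p : ℝ) ^ (-(E : ℤ))) (r : ℚ) :
    ‖(r : ℚ_[p]) - x‖ ≤ (p : ℝ) ^ (-(E : ℤ)) ↔ p ^ E ∣ r.num.natAbs := by
  have hp : p.Prime := Fact.out
  have hcentre : ‖(r : ℚ_[p]) - x‖ ≤ (p : ℝ) ^ (-(E : ℤ)) ↔
      ‖(r : ℚ_[p])‖ ≤ (p : ℝ) ^ (-(E : ℤ)) := by
    constructor <;> intro h
    · simpa using (Padic.nonarchimedean ((r : ℚ_[p]) - x) x).trans (max_le h hx)
    · simpa [sub_eq_add_neg] using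
        (Padic.nonarchimedean (r : ℚ_[p]) (-x)).trans (max_le h (by simpa using hx))
  have hnum : p ^ E ∣ r.num.natAbs ↔ ‖(r.num : ℚ_[p])‖ ≤ (p : ℝ) ^ (-(E : ℤ)) := by
    rw [Padic.norm_int_le_pow_iff_dvd, ← Int.natCast_dvd]
    push_cast
    rfl
  have hr : ‖(r : ℚ_[p])‖ = ‖(r.num : ℚ_[p])‖ / ‖(r.den : ℚ_[p])‖ := by
    rw [← norm_div, Rat.cast_def]
  rw [hcentre]
  by_cases hd : p ∣ r.den
  · have hn : ¬ p ∣ r.num.natAbs := fun h =>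
      hp.one_lt.ne' (Nat.dvd_one.1 (r.reduced ▸ Nat.dvd_gcd h hd))
    have hn1 : ‖(r.num : ℚ_[p])‖ = 1 := by
      refine le_antisymm (Padic.norm_int_le_one _) (not_lt.1 fun h => hn ?_)
      rw [Padic.norm_intCast_lt_one_iff] at h
      exact Int.natCast_dvd.1 h
    have hd0 : 0 < ‖(r.den : ℚ_[p])‖ := norm_pos_iff.2 (by exact_mod_cast r.den_nz)
    have hd1 : ‖(r.den : ℚ_[p])‖ ≤ 1 := by
      simpa using Padic.norm_int_le_one (p := p) (r.den : ℤ)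
    have hlt : (p : ℝ) ^ (-(E : ℤ)) < 1 :=
      zpow_lt_one_of_neg₀ (by exact_mod_cast hp.one_lt) (by omega)
    rw [hr, hn1]
    refine iff_of_false (fun h => ?_) (fun h => hn ((dvd_pow_self p hE.ne').trans h))
    exact absurd ((one_le_one_div hd0 hd1).trans h) (not_le.2 hlt)
  · have hd1 : ‖(r.den : ℚ_[p])‖ = 1 := by
      refine le_antisymm (by simpa using Padic.norm_int_le_one (p := p) (r.den : ℤ))
        (not_lt.1 fun h => hd ?_)
      have h' : ‖((r.den : ℤ) : ℚ_[p])‖ < 1 := by simpa using h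
      rw [Padic.norm_intCast_lt_one_iff] at h'
      exact_mod_cast h'
    rw [hr, hd1, div_one, hnum]

/-- Legendre's formula for the number of positive integers up to `n` coprime to `t`. -/
theorem card_Ioc_filter_coprime_eq_sum_moebius {t : ℕ} (ht : 0 < t) (n : ℕ) :
    (((Finset.Ioc 0 n).filter (t.Coprime ·)).card : ℤ) =
      ∑ d ∈ t.divisors, ArithmeticFunction.moebius d * ((n / d : ℕ) : ℤ) := by
  have key (k : ℕ) : (if t.Coprime k then (1 : ℤ) else 0) =
      ∑ d ∈ t.divisors, if d ∣ k then ArithmeticFunction.moebius d else 0 := by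
    have h := congrArg (fun f => f (t.gcd k)) ArithmeticFunction.moebius_mul_coe_zeta
    simp only [ArithmeticFunction.coe_mul_zeta_apply, ArithmeticFunction.one_apply] at h
    rw [← Finset.sum_filter]
    rw [show (if t.Coprime k then (1 : ℤ) else 0) = if t.gcd k = 1 then 1 else 0 from rfl, ← h]
    refine Finset.sum_congr ?_ fun _ _ => rfl
    ext d
    simp [Nat.dvd_gcd_iff, ht.ne']
  rw [Finset.card_filter, Nat.cast_sum]
  simp only [Nat.cast_ite, Nat.cast_one, Nat.cast_zero]
  rw [Finset.sum_congr rfl fun k _ => key k, Finset.sum_comm]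
  refine Finset.sum_congr rfl fun d _ => ?_
  rw [← Finset.sum_filter, Finset.sum_const, Nat.Ioc_filter_dvd_card_eq_div, nsmul_eq_mul, mul_comm]

theorem totient_eq_card_Ioc_filter_coprime (t : ℕ) :
    ((Finset.Ioc 0 t).filter (t.Coprime ·)).card = t.totient := by
  rw [← Nat.filter_coprime_Ico_eq_totient t 1]
  congr 2
  ext k
  simp only [Finset.mem_Ioc, Finset.mem_Ico]
  omega

theorem card_Ioc_filter_coprime_and_dvd {t q : ℕ} (hq : 0 < q) (h : t.Coprime q) :
    ((Finset.Ioc 0 t).filter fun m => t.Coprime m ∧ q ∣ m).card =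
      ((Finset.Ioc 0 (t / q)).filter (t.Coprime ·)).card := by
  symm
  refine Finset.card_nbij (q * ·) ?_ ?_ ?_
  · intro k hk
    simp only [Finset.coe_filter, Finset.mem_Ioc, Set.mem_ofPred_eq] at hk ⊢
    refine ⟨⟨Nat.mul_pos hq hk.1.1, ?_⟩, h.mul_right hk.2, dvd_mul_right _ _⟩
    rw [mul_comm]
    exact (Nat.le_div_iff_mul_le hq).1 hk.1.2
  · exact fun a _ b _ hab => Nat.eq_of_mul_eq_mul_left hq hab
  · rintro m hm
    simp only [Finset.coe_filter, Finset.mem_Ioc, Set.mem_ofPred_eq] at hm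
    obtain ⟨⟨h0, hmt⟩, hc, k, rfl⟩ := hm
    refine ⟨k, ?_, rfl⟩
    simp only [Finset.coe_filter, Finset.mem_Ioc, Set.mem_ofPred_eq]
    refine ⟨⟨Nat.pos_of_mul_pos_left h0, ?_⟩, hc.coprime_mul_left_right⟩
    rw [Nat.le_div_iff_mul_le hq, mul_comm]
    exact hmt

/-- Equidistribution of the totatives of `t` in the residue class `0` modulo `q`. -/
theorem abs_card_coprime_and_dvd_sub_le {t q : ℕ} (ht : 0 < t) (hq : 0 < q) (h : t.Coprime q) :
    |(((Finset.Ioc 0 t).filter fun m => t.Coprime m ∧ q ∣ m).card : ℝ) - t.totient / q| ≤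
      t.divisors.card := by
  have hA := congrArg (Int.cast : ℤ → ℝ) (card_Ioc_filter_coprime_eq_sum_moebius ht (t / q))
  have hB := congrArg (Int.cast : ℤ → ℝ) (card_Ioc_filter_coprime_eq_sum_moebius ht t)
  rw [totient_eq_card_Ioc_filter_coprime] at hB
  rw [card_Ioc_filter_coprime_and_dvd hq h]
  simp only [Int.cast_natCast, Int.cast_sum, Int.cast_mul] at hA hB
  rw [hA, hB, Finset.sum_div, ← Finset.sum_sub_distrib, Finset.cast_card]
  refine (Finset.abs_sum_le_sum_abs _ _).trans (Finset.sum_le_sum fun d _ => ?_)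
  rw [mul_div_assoc, ← mul_sub, abs_mul]
  refine mul_le_one₀ (by exact_mod_cast ArithmeticFunction.abs_moebius_le_one) (abs_nonneg _) ?_
  rw [Nat.div_right_comm, abs_sub_comm, ← Nat.floor_div_eq_div (K := ℝ) (t / d) q, abs_of_nonneg]
  · linarith [Nat.lt_floor_add_one (((t / d : ℕ) : ℝ) / q)]
  · linarith [Nat.floor_le (a := ((t / d : ℕ) : ℝ) / q) (by positivity)]

/-- Counting rationals of height `t ≥ 2` with numerator divisible by `q`: up to sign, either the
denominator or the numerator equals `t`. -/
theorem card_ratHeight_eq_and_dvd_num {t : ℕ} (ht : 2 ≤ t) (q : ℕ) :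
    Nat.card {r : ℚ // ratHeight r = t ∧ q ∣ r.num.natAbs} =
      2 * ((Finset.Ioc 0 t).filter fun m => t.Coprime m ∧ q ∣ m).card +
        2 * ((Finset.Ioc 0 t).filter fun n => t.Coprime n ∧ q ∣ t).card := by
  set B := (Finset.Ioc 0 t).filter fun m => t.Coprime m ∧ q ∣ m with hB
  set C := (Finset.Ioc 0 t).filter fun n => t.Coprime n ∧ q ∣ t with hC
  have lt_of_coprime {m : ℕ} (hm : m ≤ t) (hc : t.Coprime m) : m < t := by
    refine lt_of_le_of_ne hm ?_
    rintro rfl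
    have := (Nat.coprime_self m).1 hc
    omega
  have hBlt : ∀ m ∈ B, 0 < m ∧ m < t := fun m hm => by
    simp only [hB, Finset.mem_filter, Finset.mem_Ioc] at hm
    exact ⟨hm.1.1, lt_of_coprime hm.1.2 hm.2.1⟩
  have hClt : ∀ m ∈ C, 0 < m ∧ m < t := fun m hm => by
    simp only [hC, Finset.mem_filter, Finset.mem_Ioc] at hm
    exact ⟨hm.1.1, lt_of_coprime hm.1.2 hm.2.1⟩
  let F₁ : Finset (ℤ × ℕ) := B.image fun m : ℕ => ((m : ℤ), t)
  let F₂ : Finset (ℤ × ℕ) := B.image fun m : ℕ => (-(m : ℤ), t)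
  let F₃ : Finset (ℤ × ℕ) := C.image fun n : ℕ => ((t : ℤ), n)
  let F₄ : Finset (ℤ × ℕ) := C.image fun n : ℕ => (-(t : ℤ), n)
  have h₁₂ : Disjoint F₁ F₂ := by
    simp only [F₁, F₂, Finset.disjoint_left, Finset.mem_image, not_exists, not_and]
    rintro _ ⟨m, hm, rfl⟩ n hn h
    simp only [Prod.mk.injEq] at h
    have := hBlt m hm
    omega
  have h₃₄ : Disjoint F₃ F₄ := by
    simp only [F₃, F₄, Finset.disjoint_left, Finset.mem_image, not_exists, not_and]
    rintro _ ⟨m, hm, rfl⟩ n hn h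
    simp only [Prod.mk.injEq] at h
    omega
  have h₁₃ : Disjoint (F₁ ∪ F₂) (F₃ ∪ F₄) := by
    simp only [F₁, F₂, F₃, F₄, Finset.disjoint_left, Finset.mem_union, Finset.mem_image]
    rintro _ (⟨m, hm, rfl⟩ | ⟨m, hm, rfl⟩) (⟨n, hn, h⟩ | ⟨n, hn, h⟩) <;>
    · simp only [Prod.mk.injEq] at h
      have := hClt n hn
      omega
  have hcard : (F₁ ∪ F₂ ∪ (F₃ ∪ F₄)).card = 2 * B.card + 2 * C.card := by
    rw [Finset.card_union_of_disjoint h₁₃, Finset.card_union_of_disjoint h₁₂,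
      Finset.card_union_of_disjoint h₃₄]
    simp only [F₁, F₂, F₃, F₄]
    rw [Finset.card_image_of_injective, Finset.card_image_of_injective,
      Finset.card_image_of_injective, Finset.card_image_of_injective]
    · ring
    all_goals
      intro a b h
      simpa using h
  let e : {r : ℚ // ratHeight r = t ∧ q ∣ r.num.natAbs} ≃
      {z : ℤ × ℕ // z.2 ≠ 0 ∧ z.1.natAbs.Coprime z.2 ∧ max z.1.natAbs z.2 = t ∧
        q ∣ z.1.natAbs} :=
    { toFun := fun r => ⟨(r.1.num, r.1.den), r.1.den_nz, r.1.reduced, r.2.1, r.2.2⟩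
      invFun := fun z => ⟨⟨z.1.1, z.1.2, z.2.1, z.2.2.1⟩, z.2.2.2.1, z.2.2.2.2⟩
      left_inv := fun _ => rfl
      right_inv := fun _ => rfl }
  rw [Nat.card_congr e, ← hcard]
  refine Nat.subtype_card _ ?_
  rintro ⟨a, b⟩
  simp only [F₁, F₂, F₃, F₄, Finset.mem_union, Finset.mem_image, Prod.mk.injEq]
  constructor
  · rintro ((⟨m, hm, rfl, rfl⟩ | ⟨m, hm, rfl, rfl⟩) | (⟨m, hm, rfl, rfl⟩ | ⟨m, hm, rfl, rfl⟩))
    · have := hBlt m hm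
      simp only [hB, Finset.mem_filter] at hm
      simp only [Int.natAbs_natCast]
      exact ⟨by omega, hm.2.1.symm, by omega, hm.2.2⟩
    · have := hBlt m hm
      simp only [hB, Finset.mem_filter] at hm
      simp only [Int.natAbs_neg, Int.natAbs_natCast]
      exact ⟨by omega, hm.2.1.symm, by omega, hm.2.2⟩
    · have := hClt m hm
      simp only [hC, Finset.mem_filter] at hm
      simp only [Int.natAbs_natCast]
      exact ⟨by omega, hm.2.1, by omega, hm.2.2⟩
    · have := hClt m hm
      simp only [hC, Finset.mem_filter] at hm
      simp only [Int.natAbs_neg, Int.natAbs_natCast]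
      exact ⟨by omega, hm.2.1, by omega, hm.2.2⟩
  · rintro ⟨hb, hc, hmax, hq⟩
    have ha : a.natAbs ≠ 0 := by
      intro h0
      rw [h0] at hc hmax
      have := (Nat.coprime_zero_left b).1 hc
      omega
    simp only [hB, hC, Finset.mem_filter, Finset.mem_Ioc]
    rcases max_choice a.natAbs b with h | h
    · right
      have hat : a.natAbs = t := h.symm.trans hmax
      have hbC : (0 < b ∧ b ≤ t) ∧ t.Coprime b ∧ q ∣ t :=
        ⟨by omega, hat ▸ hc, hat ▸ hq⟩
      rcases Int.natAbs_eq a with h' | h'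
      · exact Or.inl ⟨b, hbC, by omega, rfl⟩
      · exact Or.inr ⟨b, hbC, by omega, rfl⟩
    · left
      have hbt : b = t := h.symm.trans hmax
      have haB : (0 < a.natAbs ∧ a.natAbs ≤ t) ∧ t.Coprime a.natAbs ∧ q ∣ a.natAbs :=
        ⟨by omega, hbt ▸ hc.symm, hq⟩
      rcases Int.natAbs_eq a with h' | h'
      · exact Or.inl ⟨a.natAbs, haB, by omega, hbt.symm⟩
      · exact Or.inr ⟨a.natAbs, haB, by omega, hbt.symm⟩

/-- The only rational of height `1` whose numerator is not a unit is `0`. -/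
theorem card_ratHeight_eq_one_and_dvd_num {q : ℕ} (hq : 1 < q) :
    Nat.card {r : ℚ // ratHeight r = 1 ∧ q ∣ r.num.natAbs} = 1 := by
  rw [Nat.subtype_card {(0 : ℚ)}, Finset.card_singleton]
  intro r
  rw [Finset.mem_singleton]
  constructor
  · rintro rfl
    simp [ratHeight]
  · rintro ⟨h, hd⟩
    have hle : r.num.natAbs ≤ 1 := h ▸ le_max_left _ _
    rcases Nat.eq_zero_or_pos r.num.natAbs with h0 | h0
    · exact Rat.num_eq_zero.1 (Int.natAbs_eq_zero.1 h0)
    · have := Nat.le_of_dvd h0 hd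
      omega

/-- Proposition 5 of the paper: for a prime `p`, `x ∈ ℚ_p` and a positive
integer `e` with `v_p(x) ≥ e` (true in particular for `x = 0`), the count
`N(t)` of rationals `r` of height exactly `t` with `v_p(r - x) ≥ e`
(equivalently `|r - x|_p ≤ p^{-e}`) satisfies:
`|N(t) - 2 p^{-e} φ(t)| ≤ 4 d(t)` if `v_p(t) = 0`; `N(t) = 0` if
`0 < v_p(t) < e`; and `N(t) = 2 φ(t)` if `v_p(t) ≥ e`. -/
theorem slice_count_pos_exponent
    (p : ℕ) [hp : Fact p.Prime] (x : ℚ_[p]) (e : ℤ) (he : 0 < e)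
    (hx : x = 0 ∨ e ≤ x.valuation) (t : ℕ) (ht : 0 < t) :
    (padicValNat p t = 0 →
      |(Nat.card {r : ℚ // ratHeight r = t ∧ ‖(r : ℚ_[p]) - x‖ ≤ (p : ℝ) ^ (-e)} : ℝ)
        - 2 * (p : ℝ) ^ (-e) * (t.totient : ℝ)| ≤ 4 * (t.divisors.card : ℝ)) ∧
    (0 < padicValNat p t → (padicValNat p t : ℤ) < e →
      Nat.card {r : ℚ // ratHeight r = t ∧ ‖(r : ℚ_[p]) - x‖ ≤ (p : ℝ) ^ (-e)} = 0) ∧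
    (e ≤ (padicValNat p t : ℤ) →
      Nat.card {r : ℚ // ratHeight r = t ∧ ‖(r : ℚ_[p]) - x‖ ≤ (p : ℝ) ^ (-e)}
        = 2 * t.totient) := by
  have hpp : p.Prime := hp.out
  lift e to ℕ using he.le with E
  have hE : 0 < E := by exact_mod_cast he
  have hxn : ‖x‖ ≤ (p : ℝ) ^ (-(E : ℤ)) := by
    by_cases h0 : x = 0
    · rw [h0, norm_zero]
      positivity
    · rw [Padic.norm_eq_zpow_neg_valuation h0]
      exact zpow_le_zpow_right₀ (by exact_mod_cast hpp.one_lt.le)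
        (neg_le_neg (hx.resolve_left h0))
  simp only [norm_ratCast_sub_le_iff_dvd_num p x hE hxn]
  have hq1 : 1 < p ^ E := Nat.one_lt_pow hE.ne' hpp.one_lt
  have hpos : 0 < padicValNat p t → p ∣ t := fun h => by
    by_contra hpt
    rw [padicValNat.eq_zero_of_not_dvd hpt] at h
    exact h.false
  have two_le : p ∣ t → 2 ≤ t := fun h => hpp.two_le.trans (Nat.le_of_dvd ht h)
  have card_zero : p ∣ t →
      ((Finset.Ioc 0 t).filter fun m => t.Coprime m ∧ p ^ E ∣ m).card = 0 := fun h => by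
    rw [Finset.card_eq_zero, Finset.filter_eq_empty_iff]
    rintro m - ⟨hc, hm⟩
    exact Nat.not_coprime_of_dvd_of_dvd hpp.one_lt h ((dvd_pow_self p hE.ne').trans hm) hc
  refine ⟨fun hv => ?_, fun hv hlt => ?_, fun hle => ?_⟩
  · have hpt : ¬ p ∣ t := fun h => (dvd_iff_padicValNat_ne_zero ht.ne').1 h hv
    have hcop : t.Coprime (p ^ E) := ((hpp.coprime_iff_not_dvd.2 hpt).symm).pow_right E
    rw [zpow_neg, zpow_natCast]
    rcases Nat.lt_or_ge t 2 with h2 | h2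
    · obtain rfl : t = 1 := by omega
      rw [card_ratHeight_eq_one_and_dvd_num hq1]
      have h0 : (0 : ℝ) < ((p : ℝ) ^ E)⁻¹ := by
        have := hpp.pos
        positivity
      have h1 : ((p : ℝ) ^ E)⁻¹ ≤ 1 := inv_le_one_of_one_le₀ (by exact_mod_cast hq1.le)
      simp only [Nat.totient_one, Nat.divisors_one, Finset.card_singleton, Nat.cast_one]
      rw [abs_le]
      constructor <;> linarith
    · have hndvd : ¬ p ^ E ∣ t := fun h => hpt ((dvd_pow_self p hE.ne').trans h)
      have hB := abs_card_coprime_and_dvd_sub_le ht (hpp.pos.trans_le (Nat.le_self_pow hE.ne' p))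
        hcop
      rw [card_ratHeight_eq_and_dvd_num h2]
      simp only [hndvd, and_false, Finset.filter_false, Finset.card_empty, mul_zero, add_zero]
      rw [div_eq_mul_inv] at hB
      push_cast at hB ⊢
      rw [abs_le] at hB ⊢
      have hd : (0 : ℝ) ≤ t.divisors.card := Nat.cast_nonneg _
      constructor <;> linarith
  · have hpt := hpos hv
    have hndvd : ¬ p ^ E ∣ t := by
      rw [padicValNat_dvd_iff_le ht.ne']
      omega
    rw [card_ratHeight_eq_and_dvd_num (two_le hpt), card_zero hpt]
    simp [hndvd]
  · have hdvd : p ^ E ∣ t := by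
      rw [padicValNat_dvd_iff_le ht.ne']
      omega
    have hpt := (dvd_pow_self p hE.ne').trans hdvd
    rw [card_ratHeight_eq_and_dvd_num (two_le hpt), card_zero hpt]
    simp [hdvd, totient_eq_card_Ioc_filter_coprime]
end
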